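/- arXiv:1510.05285 — 5 statements merged into one kernel-verified Lean document; each statement's English description precedes it below -/
import Mathlib

section
/- A distributive lattice has no doubly reducible elements if and only if it is a linear sum, indexed by a chain, of lattices each of which is isomorphic to the one-element lattice, to the eight-element Boolean algebra 2 × 2 × 2, or to the direct product 2 × C of the two-element chain with a chain C. -/
universe u

/-- An element `x` of a lattice is doubly reducible if `x = a ⊔ b` for some `a, b < x`
and `x = c ⊓ d` for some `c, d > x`. -/
def DoublyReducible {L : Type*} [Lattice L] (x : L) : Prop :=
  (∃ a b : L, a < x ∧ b < x ∧ a ⊔ b = x) ∧ (∃ c d : L, x < c ∧ x < d ∧ c ⊓ d = x)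

/-- `L` is the linear sum of the family of subsets `P i`, indexed by the linearly
ordered set `I`: the `P i` are pairwise disjoint sublattices covering `L`, and any element of
`P i` is strictly below any element of `P j` whenever `i < j`. -/
def IsLinearSum {L : Type*} [Lattice L] {I : Type*} [LinearOrder I] (P : I → Set L) : Prop :=
  (∀ x : L, ∃! i, x ∈ P i) ∧
  (∀ i, ∀ x ∈ P i, ∀ y ∈ P i, x ⊔ y ∈ P i ∧ x ⊓ y ∈ P i) ∧
  (∀ i j, i < j → ∀ x ∈ P i, ∀ y ∈ P j, x < y)

section NoDoublyReducible

variable {L : Type*} [DistribLattice L]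

theorem not_doublyReducible_orderDual (h : ∀ x : L, ¬ DoublyReducible x) (x : Lᵒᵈ) :
    ¬ DoublyReducible x :=
  fun hx => h (OrderDual.ofDual x) ⟨hx.2, hx.1⟩

theorem comparable_of_sup_eq_inf (h : ∀ x : L, ¬ DoublyReducible x) {a b c d : L}
    (e : a ⊔ b = c ⊓ d) : a ≤ b ∨ b ≤ a ∨ c ≤ d ∨ d ≤ c := by
  by_contra! hc
  obtain ⟨h1, h2, h3, h4⟩ := hc
  refine h (a ⊔ b) ⟨⟨a, b, left_lt_sup.2 h2, right_lt_sup.2 h1, rfl⟩, c, d, ?_, ?_, e.symm⟩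
  · rw [e]; exact inf_lt_left.2 h3
  · rw [e]; exact inf_lt_right.2 h4

theorem le_of_le_sup_of_inf_le {x y z w : L} (h : x ≤ y ⊔ z) (h1 : x ⊓ y ≤ w)
    (h2 : x ⊓ z ≤ w) : x ≤ w :=
  calc x = x ⊓ (y ⊔ z) := (inf_eq_left.2 h).symm
    _ = x ⊓ y ⊔ x ⊓ z := inf_sup_left _ _ _
    _ ≤ w := sup_le h1 h2

/-- A set is closed if, for incomparable `a` and `b`, it contains all or none of
`a`, `b`, `a ⊔ b`, `a ⊓ b`. -/
def IncompClosed (S : Set L) : Prop :=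
  ∀ a b, ¬ a ≤ b → ¬ b ≤ a → (a ∈ S ↔ b ∈ S) ∧ (a ⊔ b ∈ S ↔ a ∈ S) ∧ (a ⊓ b ∈ S ↔ a ∈ S)

theorem IncompClosed.compl {S : Set L} (hS : IncompClosed S) : IncompClosed Sᶜ := by
  intro a b hab hba
  obtain ⟨h1, h2, h3⟩ := hS a b hab hba
  exact ⟨not_congr h1, not_congr h2, not_congr h3⟩

variable (L) in
/-- A lattice that is not a linear sum in a nontrivial way. -/
def LinearlyIndecomposable : Prop :=
  ∀ S : Set L, IncompClosed S → ∀ x ∈ S, ∀ y, y ∈ S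

theorem LinearlyIndecomposable.orderDual (hc : LinearlyIndecomposable L) :
    LinearlyIndecomposable Lᵒᵈ := by
  intro S hS x hx y
  refine hc (OrderDual.toDual ⁻¹' S) ?_ (OrderDual.ofDual x) hx (OrderDual.ofDual y)
  intro a b hab hba
  obtain ⟨h1, h2, h3⟩ := hS (OrderDual.toDual a) (OrderDual.toDual b) hba hab
  exact ⟨h1, h3, h2⟩

theorem LinearlyIndecomposable.mem_Icc (h : ∀ x : L, ¬ DoublyReducible x)
    (hc : LinearlyIndecomposable L) {lo hi : L}
    (hlo : ∃ c d, ¬ c ≤ d ∧ ¬ d ≤ c ∧ c ⊓ d = lo)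
    (hhi : ∃ c d, ¬ c ≤ d ∧ ¬ d ≤ c ∧ c ⊔ d = hi) (hle : lo ≤ hi)
    (cl : ∀ x, x ≤ lo ∨ lo ≤ x) (ch : ∀ x, x ≤ hi ∨ hi ≤ x) (x : L) :
    lo ≤ x ∧ x ≤ hi := by
  obtain ⟨c, d, hcd, hdc, rfl⟩ := hlo
  obtain ⟨c', d', hcd', hdc', rfl⟩ := hhi
  refine hc {x | c ⊓ d ≤ x ∧ x ≤ c' ⊔ d'} ?_ (c ⊓ d) ⟨le_rfl, hle⟩ x
  have key : ∀ a b, ¬ a ≤ b → ¬ b ≤ a → (c ⊓ d ≤ a ∧ a ≤ c' ⊔ d') →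
      (c ⊓ d ≤ b ∧ b ≤ c' ⊔ d') := by
    rintro a b hab hba ⟨h1, h2⟩
    exact ⟨(cl b).resolve_left fun hb => hba (hb.trans h1),
      (ch b).resolve_right fun hb => hab (h2.trans hb)⟩
  intro a b hab hba
  simp only [Set.mem_ofPred_eq]
  refine ⟨⟨key a b hab hba, key b a hba hab⟩, ⟨?_, ?_⟩, ⟨?_, ?_⟩⟩
  · rintro ⟨h1, h2⟩
    refine ⟨?_, le_sup_left.trans h2⟩
    by_contra ha
    have ha' := (cl a).resolve_right ha
    have hb' := (cl b).resolve_right fun hb => hab (ha'.trans hb)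
    have := comparable_of_sup_eq_inf h (le_antisymm (sup_le ha' hb') h1)
    tauto
  · intro ha
    have hb := key a b hab hba ha
    exact ⟨ha.1.trans le_sup_left, sup_le ha.2 hb.2⟩
  · rintro ⟨h1, h2⟩
    refine ⟨h1.trans inf_le_left, ?_⟩
    by_contra ha
    have ha' := (ch a).resolve_left ha
    have hb' := (ch b).resolve_left fun hb => hba (hb.trans ha')
    have := comparable_of_sup_eq_inf h (le_antisymm (le_inf ha' hb') h2)
    tauto
  · intro ha
    have hb := key a b hab hba ha
    exact ⟨le_inf ha.1 hb.1, inf_le_left.trans ha.2⟩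

/-! ### Three-element antichains -/

/-- `a`, `b`, `c` are pairwise incomparable. -/
structure IsAntichainTriple (a b c : L) : Prop where
  ab : ¬ a ≤ b
  ba : ¬ b ≤ a
  ac : ¬ a ≤ c
  ca : ¬ c ≤ a
  bc : ¬ b ≤ c
  cb : ¬ c ≤ b

theorem IsAntichainTriple.swap_left {a b c : L} (t : IsAntichainTriple a b c) :
    IsAntichainTriple b a c := ⟨t.ba, t.ab, t.bc, t.cb, t.ac, t.ca⟩

theorem IsAntichainTriple.swap_right {a b c : L} (t : IsAntichainTriple a b c) :
    IsAntichainTriple a c b := ⟨t.ac, t.ca, t.ab, t.ba, t.cb, t.bc⟩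

theorem IsAntichainTriple.not_le_sup_of_inf_le (h : ∀ x : L, ¬ DoublyReducible x) {a b c : L}
    (t : IsAntichainTriple a b c) (h1 : a ⊓ b ≤ c) : ¬ c ≤ a ⊔ b := by
  intro h2
  have e1 : c ⊓ a ⊔ c ⊓ b = c := by rw [← inf_sup_left, inf_eq_left.2 h2]
  have e2 : (c ⊔ a) ⊓ (c ⊔ b) = c := by rw [← sup_inf_left, sup_eq_left.2 h1]
  rcases comparable_of_sup_eq_inf h (e1.trans e2.symm) with h3 | h3 | h3 | h3
  · rw [sup_eq_right.2 h3] at e1; exact t.cb (inf_eq_left.1 e1)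
  · rw [sup_eq_left.2 h3] at e1; exact t.ca (inf_eq_left.1 e1)
  · rw [inf_eq_left.2 h3] at e2; exact t.ac (sup_eq_left.1 e2)
  · rw [inf_eq_right.2 h3] at e2; exact t.bc (sup_eq_left.1 e2)

theorem IsAntichainTriple.inf_le_of_inf_le_of_inf_le (h : ∀ x : L, ¬ DoublyReducible x)
    {a b c : L} (t : IsAntichainTriple a b c) (h1 : a ⊓ b ≤ c) (h2 : a ⊓ c ≤ b) :
    b ⊓ c ≤ a := by
  rcases comparable_of_sup_eq_inf h (sup_inf_right b c a) with h3 | h3 | h3 | h3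
  · exact h3
  · exact absurd (h3.trans inf_le_left) t.ab
  · exact absurd (le_of_le_sup_of_inf_le (le_sup_left.trans h3) inf_le_right
      (inf_comm a b ▸ h1)) t.bc
  · exact absurd (le_of_le_sup_of_inf_le (le_sup_left.trans h3) inf_le_right
      (inf_comm a c ▸ h2)) t.cb

/-- The pairwise meets of an antichain `p, q, r` coincide. -/
structure IsCubeBase (p q r : L) : Prop extends IsAntichainTriple p q r where
  pq : p ⊓ q ≤ r
  pr : p ⊓ r ≤ q
  qr : q ⊓ r ≤ p

theorem IsAntichainTriple.isCubeBase (h : ∀ x : L, ¬ DoublyReducible x) {a b c : L}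
    (t : IsAntichainTriple a b c) (h1 : a ⊓ b ≤ c) : IsCubeBase a b c := by
  rcases comparable_of_sup_eq_inf h (inf_sup_right a b c).symm with h3 | h3 | h3 | h3
  · have h2 := h3.trans inf_le_left
    exact ⟨t, h1, h2, t.inf_le_of_inf_le_of_inf_le h h1 h2⟩
  · have h2 := h3.trans inf_le_left
    exact ⟨t, h1, t.swap_left.inf_le_of_inf_le_of_inf_le h (inf_comm a b ▸ h1) h2, h2⟩
  · exact absurd (le_sup_left.trans h3) t.ac
  · exact absurd h3 (t.not_le_sup_of_inf_le h h1)

theorem IsAntichainTriple.exists_isCubeBase (h : ∀ x : L, ¬ DoublyReducible x) {a b c : L}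
    (t : IsAntichainTriple a b c) : ∃ p q r : L, IsCubeBase p q r := by
  by_cases h1 : a ⊓ b ≤ c
  · exact ⟨a, b, c, t.isCubeBase h h1⟩
  by_cases h2 : a ⊓ c ≤ b
  · exact ⟨a, c, b, t.swap_right.isCubeBase h h2⟩
  by_cases h3 : b ⊓ c ≤ a
  · exact ⟨b, c, a, t.swap_left.swap_right.isCubeBase h h3⟩
  refine ⟨a ⊓ b, a ⊓ c, b ⊓ c, ⟨?_, ?_, ?_, ?_, ?_, ?_⟩, ?_, ?_, ?_⟩
  · exact fun h' => h1 (h'.trans inf_le_right)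
  · exact fun h' => h2 (h'.trans inf_le_right)
  · exact fun h' => h1 (h'.trans inf_le_right)
  · exact fun h' => h3 (h'.trans inf_le_left)
  · exact fun h' => h2 (h'.trans inf_le_left)
  · exact fun h' => h3 (h'.trans inf_le_left)
  · exact inf_le_inf inf_le_right inf_le_right
  · exact inf_le_inf inf_le_left inf_le_right
  · exact inf_le_inf inf_le_left inf_le_left

namespace IsCubeBase

variable {p q r : L}

theorem swap_left (t : IsCubeBase p q r) : IsCubeBase q p r :=
  ⟨t.toIsAntichainTriple.swap_left, inf_comm p q ▸ t.pq, t.qr, t.pr⟩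

theorem swap_right (t : IsCubeBase p q r) : IsCubeBase p r q :=
  ⟨t.toIsAntichainTriple.swap_right, t.pr, t.pq, inf_comm q r ▸ t.qr⟩

theorem not_le_sup (t : IsCubeBase p q r) : ¬ r ≤ p ⊔ q := fun h =>
  t.cb (le_of_le_sup_of_inf_le h (inf_comm p r ▸ t.pr) inf_le_right)

theorem le_or_le_of_le_sup (h : ∀ x : L, ¬ DoublyReducible x) (t : IsCubeBase p q r) {x y : L}
    (hp : p ≤ x ⊔ y) : p ≤ x ∨ p ≤ y := by
  have e1 : p ⊓ x ⊔ p ⊓ y = p := by rw [← inf_sup_left, inf_eq_left.2 hp]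
  have e2 : (p ⊔ q) ⊓ (p ⊔ r) = p := by rw [← sup_inf_left, sup_eq_left.2 t.qr]
  rcases comparable_of_sup_eq_inf h (e1.trans e2.symm) with h3 | h3 | h3 | h3
  · rw [sup_eq_right.2 h3] at e1; exact Or.inr (inf_eq_left.1 e1)
  · rw [sup_eq_left.2 h3] at e1; exact Or.inl (inf_eq_left.1 e1)
  · exact absurd (le_sup_right.trans h3) t.swap_right.not_le_sup
  · exact absurd (le_sup_right.trans h3) t.not_le_sup

theorem comparable_inf (h : ∀ x : L, ¬ DoublyReducible x) (t : IsCubeBase p q r) (x : L) :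
    x ≤ p ⊓ q ∨ p ⊓ q ≤ x := by
  rcases comparable_of_sup_eq_inf h (sup_inf_left x p q) with h3 | h3 | h3 | h3
  · exact Or.inl h3
  · exact Or.inr h3
  · rcases t.le_or_le_of_le_sup h (le_sup_right.trans h3) with h4 | h4
    · exact Or.inr (inf_le_left.trans h4)
    · exact absurd h4 t.ab
  · rcases t.swap_left.le_or_le_of_le_sup h (le_sup_right.trans h3) with h4 | h4
    · exact Or.inr (inf_le_right.trans h4)
    · exact absurd h4 t.ba

theorem orderDual (t : IsCubeBase p q r) :
    IsCubeBase (OrderDual.toDual (p ⊔ q)) (OrderDual.toDual (p ⊔ r))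
      (OrderDual.toDual (q ⊔ r)) := by
  have hr := t.not_le_sup
  have hq := t.swap_right.not_le_sup
  have hp := t.swap_left.swap_right.not_le_sup
  refine ⟨⟨?_, ?_, ?_, ?_, ?_, ?_⟩, ?_, ?_, ?_⟩
  · exact fun h' : p ⊔ r ≤ p ⊔ q => hr (le_sup_right.trans h')
  · exact fun h' : p ⊔ q ≤ p ⊔ r => hq (le_sup_right.trans h')
  · exact fun h' : q ⊔ r ≤ p ⊔ q => hr (le_sup_right.trans h')
  · exact fun h' : p ⊔ q ≤ q ⊔ r => hp (le_sup_left.trans h')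
  · exact fun h' : q ⊔ r ≤ p ⊔ r => hq (le_sup_left.trans h')
  · exact fun h' : p ⊔ r ≤ q ⊔ r => hp (le_sup_left.trans h')
  · exact (sup_le_sup le_sup_right le_sup_right : q ⊔ r ≤ (p ⊔ q) ⊔ (p ⊔ r))
  · exact (sup_le_sup le_sup_left le_sup_right : p ⊔ r ≤ (p ⊔ q) ⊔ (q ⊔ r))
  · exact (sup_le_sup le_sup_left le_sup_left : p ⊔ q ≤ (p ⊔ r) ⊔ (q ⊔ r))

theorem le_or_le (h : ∀ x : L, ¬ DoublyReducible x) (t : IsCubeBase p q r) {y : L}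
    (h1 : p ⊓ q ≤ y) (h2 : y ≤ p) : y ≤ q ∨ p ≤ y := by
  have e : y ⊔ q = (p ⊔ q) ⊓ (y ⊔ q ⊔ r) := by
    apply le_antisymm
    · exact le_inf (sup_le_sup_right h2 _) le_sup_left
    · rw [inf_sup_left]
      refine sup_le inf_le_right ?_
      rw [inf_sup_right]
      exact (sup_le t.pr inf_le_left).trans le_sup_right
  rcases comparable_of_sup_eq_inf h e with h3 | h3 | h3 | h3
  · exact Or.inl h3
  · exact absurd (h3.trans h2) t.ba
  · right
    refine le_of_le_sup_of_inf_le (le_sup_left.trans h3) ?_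
      ((le_inf inf_le_left t.pr).trans h1)
    rw [inf_sup_left]
    exact sup_le inf_le_right h1
  · exact absurd (le_sup_right.trans h3) t.not_le_sup

theorem mem_Icc (h : ∀ x : L, ¬ DoublyReducible x) (hc : LinearlyIndecomposable L)
    (t : IsCubeBase p q r) (x : L) : p ⊓ q ≤ x ∧ x ≤ (p ⊔ q) ⊔ (p ⊔ r) :=
  hc.mem_Icc h ⟨p, q, t.ab, t.ba, rfl⟩
    ⟨p ⊔ q, p ⊔ r, t.orderDual.ba, t.orderDual.ab, rfl⟩
    (inf_le_left.trans (le_sup_left.trans le_sup_left)) (t.comparable_inf h)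
    (fun x => (t.orderDual.comparable_inf (not_doublyReducible_orderDual h) x).symm) x

theorem le_iff (h : ∀ x : L, ¬ DoublyReducible x) (hc : LinearlyIndecomposable L)
    (t : IsCubeBase p q r) {x y : L} :
    x ≤ y ↔ (p ≤ x → p ≤ y) ∧ (q ≤ x → q ≤ y) ∧ (r ≤ x → r ≤ y) := by
  refine ⟨fun hxy => ⟨fun h' => h'.trans hxy, fun h' => h'.trans hxy, fun h' => h'.trans hxy⟩, ?_⟩
  have key : ∀ {a b c : L}, IsCubeBase a b c → (a ≤ x → a ≤ y) → x ⊓ a ≤ y := by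
    intro a b c s hs
    rcases s.le_or_le h (s.mem_Icc h hc (x ⊓ a)).1 inf_le_right with h1 | h1
    · exact (le_inf inf_le_right h1).trans (s.mem_Icc h hc y).1
    · exact inf_le_right.trans (hs (h1.trans inf_le_left))
  rintro ⟨h1, h2, h3⟩
  have hp := key t h1
  have hq := key t.swap_left h2
  have hr := key t.swap_right.swap_left h3
  refine le_of_le_sup_of_inf_le (t.mem_Icc h hc x).2 ?_ ?_ <;> rw [inf_sup_left]
  · exact sup_le hp hq
  · exact sup_le hp hr

open Classical in
theorem nonempty_orderIso (h : ∀ x : L, ¬ DoublyReducible x) (hc : LinearlyIndecomposable L)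
    (t : IsCubeBase p q r) : Nonempty (L ≃o (Fin 2 × Fin 2 × Fin 2)) := by
  let ind : L → L → Fin 2 := fun a x => if a ≤ x then 1 else 0
  have ind_le : ∀ a x y, ind a x ≤ ind a y ↔ (a ≤ x → a ≤ y) := by
    intro a x y
    by_cases h1 : a ≤ x <;> by_cases h2 : a ≤ y <;> simp [ind, h1, h2]
  have hle : ∀ x y, (ind p x, ind q x, ind r x) ≤ (ind p y, ind q y, ind r y) ↔ x ≤ y := by
    intro x y
    rw [t.le_iff h hc]
    simp only [Prod.mk_le_mk, ind_le]
  let f : L ↪o (Fin 2 × Fin 2 × Fin 2) :=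
    OrderEmbedding.ofMapLEIff (fun x => (ind p x, ind q x, ind r x)) hle
  refine ⟨RelIso.ofSurjective f ?_⟩
  rintro ⟨i, j, k⟩
  let o := p ⊓ q
  have op : ¬ p ≤ o := fun h' => t.ab (h'.trans inf_le_right)
  have oq : ¬ q ≤ o := fun h' => t.ba (h'.trans inf_le_left)
  have or : ¬ r ≤ o := fun h' => t.ca (h'.trans inf_le_left)
  refine ⟨(if i = 1 then p else o) ⊔ (if j = 1 then q else o) ⊔ (if k = 1 then r else o), ?_⟩
  have key : ∀ {a b c : L}, IsCubeBase a b c → ∀ x y z : L,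
      a ≤ x ⊔ y ⊔ z ↔ a ≤ x ∨ a ≤ y ∨ a ≤ z := by
    intro a b c s x y z
    constructor
    · intro h1
      rcases s.le_or_le_of_le_sup h h1 with h2 | h2
      · rcases s.le_or_le_of_le_sup h h2 with h3 | h3 <;> tauto
      · tauto
    · rintro (h1 | h1 | h1)
      · exact h1.trans (le_sup_left.trans le_sup_left)
      · exact h1.trans (le_sup_right.trans le_sup_left)
      · exact h1.trans le_sup_right
  have hp := key t
  have hq := key t.swap_left
  have hr := key t.swap_right.swap_left
  simp only [f, ind, OrderEmbedding.coe_ofMapLEIff, hp, hq, hr]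
  fin_cases i <;> fin_cases j <;> fin_cases k <;>
    simp [op, oq, or, t.ab, t.ba, t.ac, t.ca, t.bc, t.cb]

end IsCubeBase

/-! ### Products of the two-element chain with a chain -/

open Classical in
theorem exists_orderIso_fin_two_prod {L : Type u} [DistribLattice L] {a b : L} (hba : ¬ b ≤ a)
    (dich : ∀ x : L, x ⊓ b ≤ a ∨ b ≤ x ⊔ a)
    (chain : ∀ x y : L, x ⊓ b ≤ a → y ⊓ b ≤ a → x ≤ y ∨ y ≤ x)
    (up : ∀ x, x ⊓ b ≤ a → ∃ y, b ≤ y ⊔ a ∧ x ⊓ a = y ⊓ a ∧ x ⊔ b = y ⊔ b)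
    (down : ∀ x, b ≤ x ⊔ a → ∃ y, y ⊓ b ≤ a ∧ y ⊓ a = x ⊓ a ∧ y ⊔ b = x ⊔ b) :
    ∃ (C : Type u) (_ : LinearOrder C), Nonempty (L ≃o (Fin 2 × C)) := by
  let C := {x : L // x ⊓ b ≤ a}
  let lin : LinearOrder C :=
    { (inferInstance : PartialOrder C) with
      le_total := fun x y => chain x y x.2 y.2
      toDecidableLE := Classical.decRel _ }
  have cle : ∀ {c d : C}, (c : L) ≤ d → c ≤ d := fun h => h
  have hπ : ∀ x : L, ∃ c : C, (c : L) ⊓ a = x ⊓ a ∧ (c : L) ⊔ b = x ⊔ b := by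
    intro x
    rcases dich x with h1 | h1
    · exact ⟨⟨x, h1⟩, rfl, rfl⟩
    · obtain ⟨y, hy, h2⟩ := down x h1
      exact ⟨⟨y, hy⟩, h2⟩
  have mono : ∀ c d : C, (c : L) ⊓ a ≤ (d : L) ⊓ a → (c : L) ⊔ b ≤ (d : L) ⊔ b → c ≤ d := by
    intro c d h1 h2
    exact cle (le_of_le_sup_of_inf_le (le_sup_left.trans h2) inf_le_right
      ((le_inf inf_le_left c.2).trans (h1.trans inf_le_left)))
  choose π hπa hπb using hπ
  have not_both : ∀ x : L, x ⊓ b ≤ a → ¬ b ≤ x ⊔ a := fun x h1 h2 =>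
    hba (le_of_le_sup_of_inf_le h2 (inf_comm x b ▸ h1) inf_le_right)
  let ind : L → Fin 2 := fun x => if b ≤ x ⊔ a then 1 else 0
  have ind_le : ∀ x y, ind x ≤ ind y ↔ (b ≤ x ⊔ a → b ≤ y ⊔ a) := by
    intro x y
    by_cases h1 : b ≤ x ⊔ a <;> by_cases h2 : b ≤ y ⊔ a <;> simp [ind, h1, h2]
  have hle : ∀ x y, (ind x, π x) ≤ (ind y, π y) ↔ x ≤ y := by
    intro x y
    rw [Prod.mk_le_mk, ind_le]
    constructor
    · rintro ⟨h1, h2⟩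
      have h3 : (π x : L) ≤ π y := h2
      have ha : x ⊓ a ≤ y ⊓ a := by
        rw [← hπa x, ← hπa y]; exact inf_le_inf_right _ h3
      have hb : x ⊔ b ≤ y ⊔ b := by
        rw [← hπb x, ← hπb y]; exact sup_le_sup_right h3 _
      refine le_of_le_sup_of_inf_le (le_sup_left.trans hb) inf_le_right ?_
      rcases dich x with h4 | h4
      · exact (le_inf inf_le_left h4).trans (ha.trans inf_le_left)
      · refine le_of_le_sup_of_inf_le (inf_le_right.trans (h1 h4)) inf_le_right ?_
        exact (inf_le_inf_right _ inf_le_left).trans (ha.trans inf_le_left)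
    · intro hxy
      refine ⟨fun h1 => h1.trans (sup_le_sup_right hxy _), mono _ _ ?_ ?_⟩
      · rw [hπa, hπa]; exact inf_le_inf_right _ hxy
      · rw [hπb, hπb]; exact sup_le_sup_right hxy _
  refine ⟨C, lin, ⟨RelIso.ofSurjective
    (OrderEmbedding.ofMapLEIff (fun x => (ind x, π x)) hle) ?_⟩⟩
  have π_eq : ∀ x (c : C), (c : L) ⊓ a = x ⊓ a → (c : L) ⊔ b = x ⊔ b → π x = c := by
    intro x c h1 h2
    exact le_antisymm (mono _ _ (by rw [hπa, h1]) (by rw [hπb, h2]))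
      (mono _ _ (by rw [hπa, h1]) (by rw [hπb, h2]))
  rintro ⟨i, c⟩
  fin_cases i
  · refine ⟨c, Prod.ext ?_ (π_eq _ _ rfl rfl)⟩
    exact if_neg (not_both _ c.2)
  · obtain ⟨y, h1, h2, h3⟩ := up c c.2
    refine ⟨y, Prod.ext ?_ (π_eq _ _ h2 h3)⟩
    exact if_pos h1

/-- Elements `u = v ⊓ b < m < b` with `v ≰ b`: together with their joins with `v` they form a
copy of the product of a two-element and a three-element chain. -/
structure IsLadder (u v m b : L) : Prop where
  inf_eq : v ⊓ b = u
  not_le : ¬ v ≤ b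
  u_lt_m : u < m
  m_lt_b : m < b

namespace IsLadder

variable {u v m b : L}

theorem u_le_v (s : IsLadder u v m b) : u ≤ v := s.inf_eq ▸ inf_le_left

theorem u_le_b (s : IsLadder u v m b) : u ≤ b := s.inf_eq ▸ inf_le_right

theorem not_v_le_u (s : IsLadder u v m b) : ¬ v ≤ u := fun h => s.not_le (h.trans s.u_le_b)

theorem not_m_le_v (s : IsLadder u v m b) : ¬ m ≤ v := fun h =>
  s.u_lt_m.not_ge (s.inf_eq ▸ le_inf h s.m_lt_b.le)

theorem not_v_le_m (s : IsLadder u v m b) : ¬ v ≤ m := fun h => s.not_le (h.trans s.m_lt_b.le)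

theorem not_b_le_v_sup_m (s : IsLadder u v m b) : ¬ b ≤ v ⊔ m := fun h =>
  s.m_lt_b.not_ge (le_of_le_sup_of_inf_le h
    ((inf_comm v b ▸ s.inf_eq).le.trans s.u_lt_m.le) inf_le_right)

theorem m_inf_v (s : IsLadder u v m b) : m ⊓ v = u :=
  le_antisymm (s.inf_eq ▸ le_inf inf_le_right (inf_le_left.trans s.m_lt_b.le))
    (le_inf s.u_lt_m.le s.u_le_v)

theorem orderDual (s : IsLadder u v m b) :
    IsLadder (OrderDual.toDual (v ⊔ b)) (OrderDual.toDual b) (OrderDual.toDual (v ⊔ m))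
      (OrderDual.toDual v) where
  inf_eq := congrArg OrderDual.toDual (sup_comm b v)
  not_le := s.not_le
  u_lt_m := lt_of_le_not_ge (sup_le_sup_left s.m_lt_b.le v : v ⊔ m ≤ v ⊔ b)
    (fun h : v ⊔ b ≤ v ⊔ m => s.not_b_le_v_sup_m (le_sup_right.trans h))
  m_lt_b := (left_lt_sup.2 s.not_m_le_v : v < v ⊔ m)

theorem inf_le_or_le_sup (h : ∀ x : L, ¬ DoublyReducible x) (s : IsLadder u v m b) (x : L) :
    x ⊓ v ≤ u ∨ v ≤ x ⊔ u := by
  set z := x ⊓ v ⊔ u with hz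
  have huz : u ≤ z := le_sup_right
  have hzv : z ≤ v := sup_le inf_le_right s.u_le_v
  have e : z ⊔ m = (v ⊔ m) ⊓ (z ⊔ b) := by
    apply le_antisymm
    · exact le_inf (sup_le_sup_right hzv _) (sup_le_sup_left s.m_lt_b.le _)
    · rw [inf_sup_right]
      refine sup_le ?_ (inf_le_left.trans le_sup_right)
      rw [inf_sup_left, s.inf_eq]
      exact (sup_le inf_le_right huz).trans le_sup_left
  rcases comparable_of_sup_eq_inf h e with h3 | h3 | h3 | h3
  · left
    exact (s.inf_eq ▸ le_inf hzv (h3.trans s.m_lt_b.le) : z ≤ u).trans' le_sup_left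
  · exact absurd (h3.trans hzv) s.not_m_le_v
  · right
    have : v ≤ z := le_of_le_sup_of_inf_le (le_sup_left.trans h3) inf_le_right
      (s.inf_eq.le.trans huz)
    exact this.trans (sup_le_sup_right inf_le_left _)
  · exact absurd (le_sup_right.trans h3) s.not_b_le_v_sup_m

theorem comparable_or_le_sup (h : ∀ x : L, ¬ DoublyReducible x) (s : IsLadder u v m b) (x : L) :
    x ≤ u ∨ u ≤ x ∨ v ≤ x ⊔ u := by
  have e : x ⊔ u = (x ⊔ v) ⊓ (x ⊔ b) := by rw [← sup_inf_left, s.inf_eq]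
  rcases comparable_of_sup_eq_inf h e with h3 | h3 | h3 | h3
  · exact Or.inl h3
  · exact Or.inr (Or.inl h3)
  · right; right
    exact le_of_le_sup_of_inf_le (le_sup_right.trans h3) (inf_le_right.trans le_sup_left)
      (s.inf_eq.le.trans le_sup_right)
  · have hb : b ≤ x ⊔ u := le_of_le_sup_of_inf_le (le_sup_right.trans h3)
      (inf_le_right.trans le_sup_left) ((inf_comm v b ▸ s.inf_eq).le.trans le_sup_right)
    have e1 : u ⊔ m ⊓ x = m := by
      apply le_antisymm (sup_le s.u_lt_m.le inf_le_left)
      exact le_of_le_sup_of_inf_le (s.m_lt_b.le.trans hb) le_sup_right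
        (inf_le_right.trans le_sup_left)
    have e2 : b ⊓ (v ⊔ m) = m := by
      rw [inf_sup_left, inf_comm, s.inf_eq, inf_eq_right.2 s.m_lt_b.le,
        sup_eq_right.2 s.u_lt_m.le]
    rcases comparable_of_sup_eq_inf h (e1.trans e2.symm) with h4 | h4 | h4 | h4
    · exact Or.inr (Or.inl (h4.trans inf_le_right))
    · rw [sup_eq_left.2 h4] at e1
      exact absurd e1 s.u_lt_m.ne
    · exact absurd h4 s.not_b_le_v_sup_m
    · exact absurd (le_sup_left.trans h4) s.not_le

theorem exists_complement_of_le (h : ∀ x : L, ¬ DoublyReducible x)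
    (hc : LinearlyIndecomposable L) (s : IsLadder u v m b) {y : L} (hy : y ≤ u) :
    ∃ z, z ⊔ u = v ∧ z ⊓ u = y := by
  let P : L → Prop := fun y => ∃ z, z ⊔ u = v ∧ z ⊓ u = y
  let N : Set L := {y | y ≤ u ∧ ¬ P y}
  have not_le : ∀ {z}, z ⊔ u = v → ¬ z ≤ u := fun hz hzu =>
    s.not_v_le_u (hz ▸ sup_le hzu le_rfl)
  have u_irred : ∀ {a b}, a ⊔ b = u → a ≤ b ∨ b ≤ a := by
    intro a b e
    rcases comparable_of_sup_eq_inf h (e.trans s.m_inf_v.symm) with h1 | h1 | h1 | h1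
    · exact Or.inl h1
    · exact Or.inr h1
    · exact absurd h1 s.not_m_le_v
    · exact absurd h1 s.not_v_le_m
  have below : ∀ t, t ≤ u → P t → ∀ y ∈ N, y ≤ t := by
    rintro t htu ⟨z, hzv, rfl⟩ y ⟨hyu, hyP⟩
    have h0 : ¬ z ⊓ u ≤ y := fun h1 => hyP ⟨z ⊔ y, by
      rw [sup_assoc, sup_eq_right.2 hyu, hzv], by
      rw [inf_sup_right, inf_eq_left.2 hyu, sup_eq_right.2 h1]⟩
    have e : z ⊓ u ⊔ y = (z ⊔ y) ⊓ u := by rw [inf_sup_right, inf_eq_left.2 hyu]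
    rcases comparable_of_sup_eq_inf h e with h1 | h1 | h1 | h1
    · exact absurd h1 h0
    · exact h1
    · exact absurd (le_sup_left.trans h1) (not_le hzv)
    · rw [inf_eq_right.2 h1] at e
      exact (u_irred e).resolve_left h0
  have witness : ∀ x, x ∉ N → ∃ t, t ≤ x ∧ t ≤ u ∧ P t := by
    intro x hx
    by_cases hxu : x ≤ u
    · refine ⟨x, le_rfl, hxu, ?_⟩
      by_contra hP
      exact hx ⟨hxu, hP⟩
    rcases s.comparable_or_le_sup h x with h1 | h1 | h1
    · exact absurd h1 hxu
    · exact ⟨u, h1, le_rfl, v, sup_eq_left.2 s.u_le_v, inf_eq_right.2 s.u_le_v⟩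
    · refine ⟨x ⊓ u, inf_le_left, inf_le_right, x ⊓ v, ?_, ?_⟩
      · rw [sup_inf_right, sup_eq_left.2 s.u_le_v, inf_eq_right.2 h1]
      · rw [inf_assoc, inf_eq_right.2 s.u_le_v]
  have N_le : ∀ y ∈ N, ∀ x, x ∉ N → y ≤ x := by
    intro y hy x hx
    obtain ⟨t, htx, htu, ht⟩ := witness x hx
    exact (below t htu ht y hy).trans htx
  have closed : IncompClosed N := by
    intro p q hpq hqp
    have hpN : p ∈ N → q ∈ N := fun hp => by_contra fun hq => hpq (N_le p hp q hq)
    have hqN : q ∈ N → p ∈ N := fun hq => by_contra fun hp => hqp (N_le q hq p hp)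
    refine ⟨⟨hpN, hqN⟩, ⟨?_, ?_⟩, ⟨?_, ?_⟩⟩
    · intro hN
      by_contra hp
      exact hqp (le_sup_right.trans (N_le _ hN p hp))
    · intro hp
      refine ⟨sup_le hp.1 (hpN hp).1, ?_⟩
      rintro ⟨z, hzv, hz⟩
      rcases comparable_of_sup_eq_inf h hz.symm with h1 | h1 | h1 | h1
      · exact hpq h1
      · exact hqp h1
      · exact not_le hzv h1
      · rw [inf_eq_right.2 h1] at hz
        have := u_irred hz.symm
        tauto
    · intro hN
      by_contra hp
      obtain ⟨t, htp, htu, z, hzv, hz⟩ := witness p hp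
      obtain ⟨t', htq, htu', z', hzv', hz'⟩ := witness q fun hq => hp (hqN hq)
      have hP : P (t ⊓ t') := ⟨z ⊓ z', by rw [sup_inf_right, hzv, hzv', inf_idem], by
        rw [inf_inf_distrib_right, hz, hz']⟩
      have e : p ⊓ q = t ⊓ t' := le_antisymm (below _ (inf_le_left.trans htu) hP _ hN)
        (inf_le_inf htp htq)
      exact hN.2 (e ▸ hP)
    · intro hp
      by_contra hN
      exact hpq ((N_le p hp _ hN).trans inf_le_right)
  have hu : u ∈ Nᶜ := fun hu => hu.2 ⟨v, sup_eq_left.2 s.u_le_v, inf_eq_right.2 s.u_le_v⟩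
  have hyN : y ∉ N := hc Nᶜ closed.compl u hu y
  by_contra hP
  exact hyN ⟨hy, hP⟩

theorem comparable_of_inf_le (h : ∀ x : L, ¬ DoublyReducible x)
    (hc : LinearlyIndecomposable L) (hw : ∀ a b c : L, ¬ IsAntichainTriple a b c)
    (s : IsLadder u v m b) {x y : L} (hx : x ⊓ v ≤ u) (hy : y ⊓ v ≤ u) : x ≤ y ∨ y ≤ x := by
  by_contra! hxy
  obtain ⟨hxy, hyx⟩ := hxy
  have above : ∀ z, z ⊓ v ≤ u → ¬ z ≤ u → u ≤ z := by
    intro z hz hzu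
    rcases s.comparable_or_le_sup h z with h1 | h1 | h1
    · exact absurd h1 hzu
    · exact h1
    · exact absurd (le_of_le_sup_of_inf_le h1 (inf_comm z v ▸ hz) inf_le_right) s.not_v_le_u
  have incomp : ∀ z, z ⊓ v ≤ u → ¬ z ≤ u → ¬ z ≤ v ∧ ¬ v ≤ z := by
    intro z hz hzu
    refine ⟨fun h1 => hzu (inf_eq_left.2 h1 ▸ hz), fun h1 => s.not_v_le_u ?_⟩
    rwa [inf_eq_right.2 h1] at hz
  by_cases hxu : x ≤ u <;> by_cases hyu : y ≤ u
  · obtain ⟨x', hx1, rfl⟩ := s.exists_complement_of_le h hc hxu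
    obtain ⟨y', hy1, rfl⟩ := s.exists_complement_of_le h hc hyu
    have not_le : ∀ {z}, z ⊔ u = v → ¬ z ≤ u := fun hz hzu =>
      s.not_v_le_u (hz ▸ sup_le hzu le_rfl)
    exact hw x' y' u ⟨fun h1 => hxy (inf_le_inf_right _ h1), fun h1 => hyx (inf_le_inf_right _ h1),
      not_le hx1, fun h1 => hyx (le_inf (inf_le_right.trans h1) inf_le_right), not_le hy1,
      fun h1 => hxy (le_inf (inf_le_right.trans h1) inf_le_right)⟩
  · exact hxy (hxu.trans (above y hy hyu))
  · exact hyx (hyu.trans (above x hx hxu))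
  · exact hw x y v ⟨hxy, hyx, (incomp x hx hxu).1, (incomp x hx hxu).2, (incomp y hy hyu).1,
      (incomp y hy hyu).2⟩

theorem exists_orderIso {L : Type u} [DistribLattice L] {u v m b : L}
    (h : ∀ x : L, ¬ DoublyReducible x)
    (hc : LinearlyIndecomposable L) (hw : ∀ a b c : L, ¬ IsAntichainTriple a b c)
    (s : IsLadder u v m b) :
    ∃ (C : Type u) (_ : LinearOrder C), Nonempty (L ≃o (Fin 2 × C)) := by
  refine exists_orderIso_fin_two_prod s.not_v_le_u (s.inf_le_or_le_sup h)
    (fun x y => s.comparable_of_inf_le h hc hw) ?_ ?_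
  · intro x hx
    have : x ≤ u ∨ u ≤ x := by
      rcases s.comparable_or_le_sup h x with h1 | h1 | h1
      · exact Or.inl h1
      · exact Or.inr h1
      · exact absurd (le_of_le_sup_of_inf_le h1 (inf_comm x v ▸ hx) inf_le_right) s.not_v_le_u
    rcases this with h1 | h1
    · obtain ⟨z, hz, rfl⟩ := s.exists_complement_of_le h hc h1
      refine ⟨z, hz.ge, by rw [inf_assoc, inf_idem], ?_⟩
      rw [sup_eq_right.2 (h1.trans s.u_le_v), sup_eq_right.2 (hz ▸ le_sup_left)]
    · refine ⟨x ⊔ v, le_sup_right.trans le_sup_left, ?_, ?_⟩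
      · rw [inf_eq_right.2 h1, inf_eq_right.2 (h1.trans le_sup_left)]
      · rw [sup_assoc, sup_idem]
  · intro x hx
    have h' := not_doublyReducible_orderDual h
    have : x ≤ v ⊔ b ∨ v ⊔ b ≤ x := by
      rcases s.orderDual.comparable_or_le_sup h' (OrderDual.toDual x) with h1 | h1 | h1
      · exact Or.inr h1
      · exact Or.inl h1
      · have h2 : x ⊓ (v ⊔ b) ≤ b := h1
        refine absurd (le_of_le_sup_of_inf_le hx ?_ inf_le_right) s.not_v_le_u
        rw [← s.inf_eq]
        exact le_inf inf_le_left ((le_inf inf_le_right (inf_le_left.trans le_sup_left)).trans h2)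
    rcases this with h1 | h1
    · refine ⟨x ⊓ b, ?_, ?_, ?_⟩
      · rw [← s.inf_eq]
        exact le_inf inf_le_right (inf_le_left.trans inf_le_right)
      · rw [inf_assoc, inf_eq_right.2 s.u_le_b]
      · rw [sup_inf_right, sup_comm b v, inf_eq_left.2 (sup_le h1 le_sup_left)]
    · obtain ⟨z, hz1, hz2⟩ := s.orderDual.exists_complement_of_le h' hc.orderDual
        (y := OrderDual.toDual x) h1
      obtain ⟨z, rfl⟩ := OrderDual.toDual.surjective z
      have hz1 : z ⊓ (v ⊔ b) = b := hz1
      have hz2 : z ⊔ (v ⊔ b) = x := hz2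
      have hbz : b ≤ z := hz1 ▸ inf_le_left
      refine ⟨z, ?_, ?_, ?_⟩
      · rw [← s.inf_eq]
        exact le_inf inf_le_right ((inf_le_inf_left z le_sup_left).trans hz1.le)
      · rw [inf_eq_right.2 (s.u_le_b.trans hbz),
          inf_eq_right.2 (s.u_le_b.trans (le_sup_right.trans h1))]
      · rw [sup_eq_left.2 (le_sup_left.trans h1), ← hz2, sup_comm v b, ← sup_assoc,
          sup_eq_left.2 hbz]

end IsLadder

/-! ### Lattices in which all squares are covering squares -/

variable (L) in
/-- Every square `a ⊓ b, a, b, a ⊔ b` consists of covering pairs. -/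
def HasCoveringSquares : Prop :=
  ∀ a b z : L, ¬ a ≤ b → a ⊓ b < z → ¬ z < b

theorem HasCoveringSquares.orderDual (hs : HasCoveringSquares L) : HasCoveringSquares Lᵒᵈ := by
  intro a b z hab hz hzb
  induction a using OrderDual.rec with | toDual a
  induction b using OrderDual.rec with | toDual b
  induction z using OrderDual.rec with | toDual z
  have hab : ¬ b ≤ a := hab
  have hz : z < a ⊔ b := hz
  have hzb : b < z := hzb
  have hle : a ≤ a ⊓ z → a ⊔ b ≤ z := fun h1 => sup_le (h1.trans inf_le_right) hzb.le
  refine hs b a (a ⊓ z) hab ?_ (lt_of_le_not_ge inf_le_left fun h1 => hz.not_ge (hle h1))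
  refine lt_of_le_not_ge (le_inf inf_le_right (inf_le_left.trans hzb.le)) fun h1 => ?_
  exact hzb.not_ge (le_of_le_sup_of_inf_le hz.le (inf_comm a z ▸ h1.trans inf_le_left)
    inf_le_right)

theorem HasCoveringSquares.comparable_inf (h : ∀ x : L, ¬ DoublyReducible x)
    (hs : HasCoveringSquares L) {a b : L} (hab : ¬ a ≤ b) (hba : ¬ b ≤ a) (x : L) :
    x ≤ a ⊓ b ∨ a ⊓ b ≤ x := by
  by_contra! hx
  obtain ⟨h1, h2⟩ := hx
  have key : ∀ a b : L, ¬ a ≤ b → ¬ b ≤ a → ¬ x ≤ a ⊓ b → ¬ a ⊓ b ≤ x → ¬ a ≤ x ⊔ b := by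
    intro a b hab hba h1 h2 h3
    have h4 : a ≤ x ⊔ a ⊓ b :=
      le_of_le_sup_of_inf_le h3 (inf_le_right.trans le_sup_left) le_sup_right
    have hoa : ¬ a ⊓ x ≤ a ⊓ b ⊓ x := fun h5 => hab
      ((le_of_le_sup_of_inf_le h4 (h5.trans inf_le_left) inf_le_right).trans inf_le_right)
    have hxa : x ≤ a := by
      by_contra hxa
      exact hs (a ⊓ b) x (a ⊓ x) h2 (lt_of_le_not_ge (inf_le_inf_right _ inf_le_left) hoa)
        (inf_lt_right.2 hxa)
    exact hs x b (a ⊓ b) (fun h5 => h1 (le_inf hxa h5))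
      (lt_of_le_not_ge (inf_le_inf_right _ hxa) fun h5 => h2 (h5.trans inf_le_left))
      (inf_lt_right.2 hba)
  rcases comparable_of_sup_eq_inf h (sup_inf_left x a b) with h3 | h3 | h3 | h3
  · exact h1 h3
  · exact h2 h3
  · exact key a b hab hba h1 h2 (le_sup_right.trans h3)
  · exact key b a hba hab (inf_comm a b ▸ h1) (inf_comm a b ▸ h2) (le_sup_right.trans h3)

theorem HasCoveringSquares.exists_orderIso {L : Type u} [DistribLattice L]
    (h : ∀ x : L, ¬ DoublyReducible x) (hc : LinearlyIndecomposable L)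
    (hs : HasCoveringSquares L) {a b : L} (hab : ¬ a ≤ b) (hba : ¬ b ≤ a) :
    ∃ (C : Type u) (_ : LinearOrder C), Nonempty (L ≃o (Fin 2 × C)) := by
  have hI : ∀ x, a ⊓ b ≤ x ∧ x ≤ a ⊔ b :=
    hc.mem_Icc h ⟨a, b, hab, hba, rfl⟩ ⟨a, b, hab, hba, rfl⟩ (inf_le_left.trans le_sup_left)
      (hs.comparable_inf h hab hba) (fun x => (hs.orderDual.comparable_inf
        (not_doublyReducible_orderDual h) (a := OrderDual.toDual a) (b := OrderDual.toDual b)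
        hba hab x).symm)
  have cover : ∀ x, x ≤ b → x ≤ a ⊓ b ∨ b ≤ x := by
    intro x hx
    by_contra! h1
    exact hs a b x hab (lt_of_le_not_ge (hI x).1 h1.1) (lt_of_le_not_ge hx h1.2)
  refine exists_orderIso_fin_two_prod (a := a ⊓ b) (b := a)
    (fun h1 => hab (h1.trans inf_le_right)) ?_ ?_ ?_ ?_
  · intro x
    by_contra! h1
    refine hs b a (x ⊓ a) hba ?_ (inf_lt_right.2 fun h2 => h1.2 (h2.trans le_sup_left))
    rw [inf_comm]
    exact lt_of_le_not_ge (hI _).1 h1.1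
  · intro x y hx hy
    have le_b : ∀ z, z ⊓ a ≤ a ⊓ b → z ≤ b := fun z hz =>
      le_of_le_sup_of_inf_le (hI z).2 (hz.trans inf_le_right) inf_le_right
    rcases cover x (le_b x hx) with h1 | h1
    · exact Or.inl (h1.trans (hI y).1)
    · exact Or.inr ((le_b y hy).trans h1)
  · intro x _
    refine ⟨x ⊔ a, le_sup_right.trans le_sup_left, ?_, ?_⟩
    · rw [inf_eq_right.2 (hI x).1, inf_eq_right.2 (hI _).1]
    · rw [sup_assoc, sup_idem]
  · intro x _
    refine ⟨x ⊓ b, ?_, ?_, ?_⟩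
    · exact le_inf inf_le_right (inf_le_left.trans inf_le_right)
    · rw [inf_eq_right.2 (hI x).1, inf_eq_right.2 (hI _).1]
    · rw [sup_inf_right, sup_comm b a, inf_eq_left.2 (hI _).2]

/-! ### The classification of linearly indecomposable lattices -/

theorem LinearlyIndecomposable.classification {L : Type u} [DistribLattice L] [Nonempty L]
    (h : ∀ x : L, ¬ DoublyReducible x) (hc : LinearlyIndecomposable L) :
    Nonempty (L ≃o Fin 1) ∨ Nonempty (L ≃o (Fin 2 × Fin 2 × Fin 2)) ∨
      ∃ (C : Type u) (_ : LinearOrder C), Nonempty (L ≃o (Fin 2 × C)) := by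
  by_cases hchain : ∀ a b : L, a ≤ b ∨ b ≤ a
  · left
    obtain ⟨x⟩ := ‹Nonempty L›
    have hx : ∀ y, y = x := hc {x} (fun a b hab hba => by
      have := hchain a b
      tauto) x rfl
    have : Unique L := ⟨⟨x⟩, hx⟩
    exact ⟨OrderIso.ofUnique L (Fin 1)⟩
  right
  by_cases hw : ∀ a b c : L, ¬ IsAntichainTriple a b c
  · right
    by_cases hs : HasCoveringSquares L
    · push Not at hchain
      obtain ⟨a, b, hab, hba⟩ := hchain
      exact hs.exists_orderIso h hc hab hba
    · unfold HasCoveringSquares at hs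
      push Not at hs
      obtain ⟨a, b, z, hab, hz, hzb⟩ := hs
      exact IsLadder.exists_orderIso h hc hw ⟨rfl, hab, hz, hzb⟩
  · left
    push Not at hw
    obtain ⟨a, b, c, t⟩ := hw
    obtain ⟨p, q, r, s⟩ := t.exists_isCubeBase h
    exact s.nonempty_orderIso h hc

/-! ### The decomposition into linearly indecomposable blocks -/

variable (L) in
/-- Two elements are in the same block if no closed set separates them. -/
def blockSetoid : Setoid L where
  r x y := ∀ S : Set L, IncompClosed S → (x ∈ S ↔ y ∈ S)
  iseqv := ⟨fun _ _ _ => Iff.rfl, fun h S hS => (h S hS).symm,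
    fun h h' S hS => (h S hS).trans (h' S hS)⟩

theorem blockSetoid_of_incomp {a b : L} (hab : ¬ a ≤ b) (hba : ¬ b ≤ a) :
    blockSetoid L a b ∧ blockSetoid L a (a ⊔ b) ∧ blockSetoid L a (a ⊓ b) :=
  ⟨fun _ hS => (hS a b hab hba).1, fun _ hS => (hS a b hab hba).2.1.symm,
    fun _ hS => (hS a b hab hba).2.2.symm⟩

theorem le_total_of_not_blockSetoid {a b : L} (h : ¬ blockSetoid L a b) : a ≤ b ∨ b ≤ a := by
  by_contra! hab
  exact h (blockSetoid_of_incomp hab.1 hab.2).1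

theorem incompClosed_block (x : L) : IncompClosed {y | blockSetoid L y x} := by
  intro a b hab hba
  obtain ⟨h1, h2, h3⟩ := blockSetoid_of_incomp hab hba
  have tr : ∀ {c}, blockSetoid L a c → (blockSetoid L c x ↔ blockSetoid L a x) := fun hc =>
    ⟨fun h => (blockSetoid L).trans hc h,
      fun h => (blockSetoid L).trans ((blockSetoid L).symm hc) h⟩
  exact ⟨(tr h1).symm, tr h2, tr h3⟩

theorem incompClosed_lt_block (x : L) : IncompClosed {y | y < x ∧ ¬ blockSetoid L y x} := by
  intro a b hab hba
  obtain ⟨h1, h2, h3⟩ := incompClosed_block x a b hab hba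
  simp only [Set.mem_ofPred_eq] at h1 h2 h3 ⊢
  rw [h2, h3, ← h1]
  by_cases ha : blockSetoid L a x
  · simp [ha]
  have ne : ∀ {c}, ¬ blockSetoid L c x → c ≠ x := by
    rintro c hc rfl
    exact hc ((blockSetoid L).refl c)
  have ca := le_total_of_not_blockSetoid ha
  have cb := le_total_of_not_blockSetoid (h1.not.1 ha)
  have hb : a < x → b ≤ x := fun hlt => cb.resolve_right fun h => hab (hlt.le.trans h)
  simp only [ha, not_false_eq_true, and_true]
  refine ⟨⟨fun hlt => (hb hlt).lt_of_ne (ne (h1.not.1 ha)), fun hlt =>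
      (ca.resolve_right fun h => hba (hlt.le.trans h)).lt_of_ne (ne ha)⟩,
    ⟨fun hlt => le_sup_left.trans_lt hlt, fun hlt =>
      (sup_le hlt.le (hb hlt)).lt_of_ne (ne (h2.not.2 ha))⟩,
    ⟨fun hlt => ?_, fun hlt => inf_le_left.trans_lt hlt⟩⟩
  refine (ca.resolve_right fun h => ?_).lt_of_ne (ne ha)
  rcases cb with h' | h'
  · exact hba (h'.trans h)
  · exact hlt.not_ge (le_inf h h')

theorem lt_of_blockSetoid {i j x y : L} (hij : i < j) (hn : ¬ blockSetoid L i j)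
    (hx : blockSetoid L x i) (hy : blockSetoid L y j) : x < y := by
  have hxj := (hx _ (incompClosed_lt_block j)).2 ⟨hij, hn⟩
  have hxy : ¬ blockSetoid L x y := fun h => hxj.2 ((blockSetoid L).trans h hy)
  refine lt_of_le_not_ge ((le_total_of_not_blockSetoid hxy).resolve_right fun h => ?_)
    fun h => ?_
  all_goals
    have hlt : y < x := lt_of_le_of_ne h (by rintro rfl; exact hxy ((blockSetoid L).refl _))
    have := (hy _ (incompClosed_lt_block x)).1 ⟨hlt, fun h => hxy ((blockSetoid L).symm h)⟩
    exact lt_asymm this.1 hxj.1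

/-- A block, as a sublattice. -/
def blockSublattice (x : L) : Sublattice L where
  carrier := {y | blockSetoid L y x}
  supClosed' a ha b hb := by
    by_cases hab : a ≤ b
    · rwa [sup_eq_right.2 hab]
    by_cases hba : b ≤ a
    · rwa [sup_eq_left.2 hba]
    exact (incompClosed_block x a b hab hba).2.1.2 ha
  infClosed' a ha b hb := by
    by_cases hab : a ≤ b
    · rwa [inf_eq_left.2 hab]
    by_cases hba : b ≤ a
    · rwa [inf_eq_right.2 hba]
    exact (incompClosed_block x a b hab hba).2.2.2 ha

theorem linearlyIndecomposable_block (x : L) : LinearlyIndecomposable (blockSublattice x) := by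
  intro S hS y hy z
  have key : IncompClosed ((↑) '' S : Set L) := by
    have img : ∀ (a : L) (ha : a ∈ blockSublattice x),
        a ∈ ((↑) '' S : Set L) ↔ (⟨a, ha⟩ : blockSublattice x) ∈ S := by
      intro a ha
      constructor
      · rintro ⟨b, hb, rfl⟩; exact hb
      · exact fun h => ⟨_, h, rfl⟩
    have out : ∀ a : L, a ∉ blockSublattice x → a ∉ ((↑) '' S : Set L) := by
      rintro _ ha ⟨b, _, rfl⟩
      exact ha b.2
    intro a b hab hba
    obtain ⟨h1, h2, h3⟩ := incompClosed_block x a b hab hba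
    by_cases ha : a ∈ blockSublattice x
    · have hb : b ∈ blockSublattice x := h1.1 ha
      rw [img a ha, img b hb, img _ (h2.2 ha), img _ (h3.2 ha)]
      exact hS ⟨a, ha⟩ ⟨b, hb⟩ hab hba
    · have hb : b ∉ blockSublattice x := fun h => ha (h1.2 h)
      simp only [out a ha, out b hb, out _ fun h => ha (h2.1 h), out _ fun h => ha (h3.1 h),
        iff_self, and_self]
  have hyz : blockSetoid L y z := (blockSetoid L).trans y.2 ((blockSetoid L).symm z.2)
  obtain ⟨w, hw, hwz⟩ := (hyz _ key).1 ⟨y, hy, rfl⟩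
  rwa [← Subtype.ext hwz]

theorem Sublattice.not_doublyReducible (h : ∀ x : L, ¬ DoublyReducible x) (N : Sublattice L)
    (x : N) : ¬ DoublyReducible x := by
  rintro ⟨⟨a, b, ha, hb, hab⟩, c, d, hc, hd, hcd⟩
  exact h x ⟨⟨a, b, ha, hb, congrArg Subtype.val hab⟩, c, d, hc, hd, congrArg Subtype.val hcd⟩

theorem exists_isLinearSum {L : Type u} [DistribLattice L] (h : ∀ x : L, ¬ DoublyReducible x) :
    ∃ (I : Type u) (_ : LinearOrder I) (P : I → Set L),
      IsLinearSum P ∧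
      ∀ i : I,
        Nonempty (↥(P i) ≃o Fin 1) ∨
        Nonempty (↥(P i) ≃o (Fin 2 × Fin 2 × Fin 2)) ∨
        ∃ (C : Type u) (_ : LinearOrder C), Nonempty (↥(P i) ≃o (Fin 2 × C)) := by
  let I := Quotient (blockSetoid L)
  have out_not : ∀ {i j : I}, i ≠ j → ¬ blockSetoid L i.out j.out := fun {i j} hij hr =>
    hij (by rw [← Quotient.out_eq i, ← Quotient.out_eq j]; exact Quotient.sound hr)
  let lin : LinearOrder I :=
    { PartialOrder.lift (Quotient.out : I → L) Quotient.out_injective with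
      le_total := fun i j => by
        by_cases hij : i = j
        · subst hij; exact Or.inl (le_refl i.out)
        · exact le_total_of_not_blockSetoid (out_not hij)
      toDecidableLE := Classical.decRel _ }
  refine ⟨I, lin, fun i => blockSublattice i.out, ⟨?_, ?_, ?_⟩, ?_⟩
  · intro x
    refine ⟨Quotient.mk _ x, (blockSetoid L).symm (Quotient.mk_out x), fun i hi => ?_⟩
    rw [← Quotient.out_eq i]
    exact (Quotient.sound hi).symm
  · exact fun i x hx y hy =>
      ⟨(blockSublattice i.out).supClosed hx hy, (blockSublattice i.out).infClosed hx hy⟩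
  · intro i j hij x hx y hy
    have hlt : i.out < j.out := hij
    exact lt_of_blockSetoid hlt (out_not fun e => hlt.ne (congrArg _ e)) hx hy
  · intro i
    have : Nonempty (blockSublattice i.out) := ⟨⟨i.out, (blockSetoid L).refl _⟩⟩
    exact (linearlyIndecomposable_block i.out).classification
      (Sublattice.not_doublyReducible h _)

/-! ### Linear sums without doubly reducible elements -/

theorem not_doublyReducible_fin_two_prod {C : Type*} [LinearOrder C] (x : Fin 2 × C) :
    ¬ DoublyReducible x := by
  obtain ⟨i, t⟩ := x
  rintro ⟨⟨a, b, ha, hb, hab⟩, c, d, hc, hd, hcd⟩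
  have h0 : i = 0 ∨ i = 1 := by omega
  rcases h0 with rfl | rfl
  · have h1 : ∀ y : Fin 2 × C, y ≤ (0, t) → y.2 = t → y = (0, t) := fun y hy h2 =>
      Prod.ext (Fin.le_zero_iff.1 hy.1) h2
    have h2 : a.2 ⊔ b.2 = t := congrArg Prod.snd hab
    rcases le_total a.2 b.2 with h3 | h3
    · exact hb.ne (h1 b hb.le (by rwa [sup_eq_right.2 h3] at h2))
    · exact ha.ne (h1 a ha.le (by rwa [sup_eq_left.2 h3] at h2))
  · have h1 : ∀ y : Fin 2 × C, (1, t) ≤ y → y.2 = t → (1, t) = y := fun y hy h2 =>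
      Prod.ext (le_antisymm hy.1 (Fin.le_last y.1)) h2.symm
    have h2 : c.2 ⊓ d.2 = t := congrArg Prod.snd hcd
    rcases le_total c.2 d.2 with h3 | h3
    · exact hc.ne (h1 c hc.le (by rwa [inf_eq_left.2 h3] at h2))
    · exact hd.ne (h1 d hd.le (by rwa [inf_eq_right.2 h3] at h2))

set_option synthInstance.maxSize 2000 in
set_option synthInstance.maxHeartbeats 400000 in
theorem not_doublyReducible_cube (x : Fin 2 × Fin 2 × Fin 2) : ¬ DoublyReducible x := by
  simp only [DoublyReducible, lt_iff_le_and_ne, Prod.le_def]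
  revert x
  decide

theorem DoublyReducible.map_orderIso {L K : Type*} [Lattice L] [Lattice K] {S : Set L}
    (e : S ≃o K) {a b c d x : S}
    (ha : a < x) (hb : b < x) (hab : (a ⊔ b : L) = x) (hc : x < c) (hd : x < d)
    (hcd : (c ⊓ d : L) = x) : DoublyReducible (e x) := by
  refine ⟨⟨e a, e b, e.lt_iff_lt.2 ha, e.lt_iff_lt.2 hb, ?_⟩,
    e c, e d, e.lt_iff_lt.2 hc, e.lt_iff_lt.2 hd, ?_⟩
  · refine le_antisymm (sup_le (e.monotone ha.le) (e.monotone hb.le)) ?_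
    rw [← e.le_symm_apply]
    have h1 : a ≤ e.symm (e a ⊔ e b) := e.le_symm_apply.2 le_sup_left
    have h2 : b ≤ e.symm (e a ⊔ e b) := e.le_symm_apply.2 le_sup_right
    exact (hab ▸ sup_le h1 h2 : (x : L) ≤ e.symm (e a ⊔ e b))
  · refine le_antisymm ?_ (le_inf (e.monotone hc.le) (e.monotone hd.le))
    rw [← e.symm_apply_le]
    have h1 : e.symm (e c ⊓ e d) ≤ c := e.symm_apply_le.2 inf_le_left
    have h2 : e.symm (e c ⊓ e d) ≤ d := e.symm_apply_le.2 inf_le_right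
    exact (hcd ▸ le_inf h1 h2 : (e.symm (e c ⊓ e d) : L) ≤ x)

theorem IsLinearSum.mem_of_sup_eq {L I : Type*} [Lattice L] [LinearOrder I] {P : I → Set L}
    (hP : IsLinearSum P) {i : I} {a b x : L} (hx : x ∈ P i) (ha : a < x) (hb : b < x)
    (hab : a ⊔ b = x) : a ∈ P i := by
  obtain ⟨cover, sub, lt⟩ := hP
  obtain ⟨j, hj, -⟩ := cover a
  obtain ⟨k, hk, -⟩ := cover b
  rcases lt_trichotomy j i with hji | rfl | hij
  · exfalso
    rcases lt_trichotomy j k with h1 | rfl | h1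
    · rw [sup_eq_right.2 (lt _ _ h1 _ hj _ hk).le] at hab
      exact hb.ne hab
    · exact hji.ne ((cover x).unique (hab ▸ (sub _ _ hj _ hk).1) hx)
    · rw [sup_eq_left.2 (lt _ _ h1 _ hk _ hj).le] at hab
      exact ha.ne hab
  · exact hj
  · exact absurd (lt _ _ hij _ hx _ hj) ha.not_gt

theorem IsLinearSum.mem_of_inf_eq {L I : Type*} [Lattice L] [LinearOrder I] {P : I → Set L}
    (hP : IsLinearSum P) {i : I} {a b x : L} (hx : x ∈ P i) (ha : x < a) (hb : x < b)
    (hab : a ⊓ b = x) : a ∈ P i :=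
  IsLinearSum.mem_of_sup_eq (L := Lᵒᵈ) (I := Iᵒᵈ) (P := P)
    ⟨hP.1, fun i x hx y hy => (hP.2.1 i x hx y hy).symm,
      fun i j hij x hx y hy => hP.2.2 j i hij y hy x hx⟩ hx ha hb hab

theorem IsLinearSum.exists_doublyReducible {L I : Type*} [Lattice L] [LinearOrder I]
    {P : I → Set L} (hP : IsLinearSum P) {i : I} {x : L} (hx : x ∈ P i)
    (h : DoublyReducible x) {K : Type*} [Lattice K] (e : P i ≃o K) :
    ∃ y : K, DoublyReducible y := by
  obtain ⟨⟨a, b, ha, hb, hab⟩, c, d, hc, hd, hcd⟩ := h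
  exact ⟨_, DoublyReducible.map_orderIso e (x := ⟨x, hx⟩)
    (a := ⟨a, hP.mem_of_sup_eq hx ha hb hab⟩)
    (b := ⟨b, hP.mem_of_sup_eq hx hb ha (sup_comm a b ▸ hab)⟩)
    (c := ⟨c, hP.mem_of_inf_eq hx hc hd hcd⟩)
    (d := ⟨d, hP.mem_of_inf_eq hx hd hc (inf_comm c d ▸ hcd)⟩) ha hb hab hc hd hcd⟩

end NoDoublyReducible

/-- A distributive lattice has no doubly reducible elements if and only if it is a linear sum,
indexed by a chain, of lattices each of which is isomorphic to the one-element lattice, to the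
eight-element Boolean algebra `2 × 2 × 2`, or to the direct product `2 × C` of the two-element
chain with a chain `C`. -/
theorem statement1 (L : Type u) [DistribLattice L] :
    (∀ x : L, ¬ DoublyReducible x) ↔
      ∃ (I : Type u) (_ : LinearOrder I) (P : I → Set L),
        IsLinearSum P ∧
        ∀ i : I,
          Nonempty (↥(P i) ≃o Fin 1) ∨
          Nonempty (↥(P i) ≃o (Fin 2 × Fin 2 × Fin 2)) ∨
          ∃ (C : Type u) (_ : LinearOrder C), Nonempty (↥(P i) ≃o (Fin 2 × C)) := by
  constructor
  · exact exists_isLinearSum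
  · rintro ⟨I, _, P, hP, hiso⟩ x hx
    obtain ⟨i, hi, -⟩ := hP.1 x
    rcases hiso i with ⟨⟨e⟩⟩ | ⟨⟨e⟩⟩ | ⟨C, _, ⟨e⟩⟩
    · obtain ⟨y, ⟨a, _, ha, _⟩, _⟩ := hP.exists_doublyReducible hi hx e
      exact ha.ne (Subsingleton.elim _ _)
    · obtain ⟨y, hy⟩ := hP.exists_doublyReducible hi hx e
      exact not_doublyReducible_cube y hy
    · obtain ⟨y, hy⟩ := hP.exists_doublyReducible hi hx e
      exact not_doublyReducible_fin_two_prod y hy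
end

section
/- Every distributive lattice with no doubly reducible elements satisfies Whitman's condition. -/
/-- Every distributive lattice with no doubly reducible elements satisfies
Whitman's condition. -/
theorem statement7 (L : Type*) [DistribLattice L]
    (hdr : ∀ x : L, ¬ DoublyReducible x) :
    ∀ a b c d : L, a ⊓ b ≤ c ⊔ d → a ≤ c ⊔ d ∨ b ≤ c ⊔ d ∨ a ⊓ b ≤ c ∨ a ⊓ b ≤ d := by
  intro a b c d h
  by_contra! hcon
  obtain ⟨ha, hb, hc, hd⟩ := hcon
  refine hdr (a ⊓ b) ⟨⟨a ⊓ b ⊓ c, a ⊓ b ⊓ d, inf_lt_left.2 hc, inf_lt_left.2 hd, ?_⟩,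
    a, b, ?_, ?_, rfl⟩
  · rw [← inf_sup_left, inf_eq_left.2 h]
  · exact inf_lt_left.2 fun hab => ha ((le_inf le_rfl hab).trans h)
  · exact inf_lt_right.2 fun hba => hb ((le_inf hba le_rfl).trans h)
end

section
/- Let L be a join-semidistributive lattice and let a, b, c, d ∈ L satisfy: b covers a, d covers c, a ≤ c, and b ⊔ c = d. Then there is no element x ∈ L with a < x < d such that x is incomparable to b and x is incomparable to c. -/
/-- Let `L` be a join-semidistributive lattice and let `a, b, c, d ∈ L` satisfy: `b` covers `a`,
`d` covers `c`, `a ≤ c`, and `b ⊔ c = d`. Then there is no element `x ∈ L` with `a < x < d`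
such that `x` is incomparable to `b` and `x` is incomparable to `c`. -/
theorem statement12 (L : Type*) [Lattice L]
    (hSD : ∀ a b c : L, a ⊔ b = a ⊔ c → a ⊔ b = a ⊔ (b ⊓ c))
    (a b c d : L) (hab : a ⋖ b) (hcd : c ⋖ d) (hac : a ≤ c) (hbd : b ⊔ c = d) :
    ¬ ∃ x : L, a < x ∧ x < d ∧ (¬ x ≤ b ∧ ¬ b ≤ x) ∧ (¬ x ≤ c ∧ ¬ c ≤ x) := by
  rintro ⟨x, hax, hxd, ⟨-, hbx⟩, hxc, -⟩
  have hcx : c ⊔ x = d :=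
    (hcd.eq_or_eq le_sup_left (sup_le hcd.le hxd.le)).resolve_left fun h => hxc (sup_eq_left.mp h)
  have hbxa : b ⊓ x = a :=
    (hab.eq_or_eq (le_inf hab.le hax.le) inf_le_left).resolve_right fun h => hbx (inf_eq_left.mp h)
  have hcb : c ⊔ b = d := by rw [sup_comm, hbd]
  have h := hSD c b x (hcb.trans hcx.symm)
  rw [hcb, hbxa, sup_eq_left.mpr hac] at h
  exact hcd.ne h.symm
end

section
/- Let L be a countably infinite semidistributive lattice satisfying Whitman's condition in which every closed interval [u, v] = {w : u ≤ w ≤ v} is finite, and suppose L has a spanning cover a ⋖ b. Then L contains a sublattice H together with a lattice isomorphism φ : 2 × ℤ → H such that φ(0, 0) = a and φ(1, 0) = b, and H has no upper bound and no lower bound in L. -/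
/-- A covering pair `a ⋖ b` in a lattice `L` is a spanning cover of `L` if there are sequences
`a < a₁ < a₂ < ⋯` having no upper bound in `L` and `b > b₁ > b₂ > ⋯` having no lower bound in
`L` such that `b` is incomparable to every `aₖ` and `a` is incomparable to every `bₖ`. -/
def IsSpanningCover {L : Type*} [Lattice L] (a b : L) : Prop :=
  a ⋖ b ∧
  (∃ f : ℕ → L, a < f 0 ∧ StrictMono f ∧ (¬ ∃ u : L, ∀ n, f n ≤ u) ∧
    ∀ n, ¬ b ≤ f n ∧ ¬ f n ≤ b) ∧
  (∃ g : ℕ → L, g 0 < b ∧ StrictAnti g ∧ (¬ ∃ l : L, ∀ n, l ≤ g n) ∧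
    ∀ n, ¬ a ≤ g n ∧ ¬ g n ≤ a)

/-- The elements `x ≥ a` not above `b` that are maximal with these properties below `b ⊔ x`. -/
def IsJoinClosed {L : Type*} [Lattice L] (a b x : L) : Prop :=
  a ≤ x ∧ ¬ b ≤ x ∧ ∀ y, a ≤ y → ¬ b ≤ y → y ≤ b ⊔ x → y ≤ x

theorem inf_eq_of_covBy {L : Type*} [Lattice L] {a b x : L} (hab : a ⋖ b) (hax : a ≤ x)
    (hbx : ¬ b ≤ x) : b ⊓ x = a := by
  rcases hab.eq_or_eq (le_inf hab.le hax) inf_le_left with h | h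
  · exact h
  · exact absurd (inf_eq_left.mp h) hbx

theorem not_le_sup_of_covBy {L : Type*} [Lattice L]
    (hSDm : ∀ a b c : L, a ⊓ b = a ⊓ c → a ⊓ b = a ⊓ (b ⊔ c))
    {a b x y : L} (hab : a ⋖ b) (hax : a ≤ x) (hbx : ¬ b ≤ x) (hay : a ≤ y) (hby : ¬ b ≤ y) :
    ¬ b ≤ x ⊔ y := by
  intro h
  have hx := inf_eq_of_covBy hab hax hbx
  have hxy := hSDm b x y (hx.trans (inf_eq_of_covBy hab hay hby).symm)
  rw [hx, inf_eq_left.mpr h] at hxy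
  exact hab.lt.ne hxy

theorem isJoinClosed_self_of_covBy {L : Type*} [Lattice L] {a b : L} (hab : a ⋖ b) :
    IsJoinClosed a b a := by
  refine ⟨le_rfl, hab.lt.not_ge, fun y hay hby hy => ?_⟩
  rw [sup_eq_left.mpr hab.le] at hy
  rw [← inf_eq_of_covBy hab hay hby]
  exact le_inf hy le_rfl

theorem exists_isJoinClosed_ge {L : Type*} [Lattice L]
    (hSDm : ∀ a b c : L, a ⊓ b = a ⊓ c → a ⊓ b = a ⊓ (b ⊔ c))
    (hfin : ∀ u v : L, (Set.Icc u v).Finite)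
    {a b x : L} (hab : a ⋖ b) (hax : a ≤ x) (hbx : ¬ b ≤ x) :
    ∃ y, IsJoinClosed a b y ∧ x ≤ y := by
  have hs : ({y | a ≤ y ∧ ¬ b ≤ y ∧ y ≤ b ⊔ x} : Set L).Finite :=
    (hfin a (b ⊔ x)).subset fun y hy => ⟨hy.1, hy.2.2⟩
  obtain ⟨y, hxy, ⟨hay, hby, hyx⟩, hmax⟩ := hs.exists_le_maximal
    (show x ∈ _ from ⟨hax, hbx, le_sup_right⟩)
  refine ⟨y, ⟨hay, hby, fun z haz hbz hz => ?_⟩, hxy⟩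
  have hzx : z ≤ b ⊔ x := hz.trans (sup_le le_sup_left hyx)
  exact le_sup_right.trans (hmax ⟨hay.trans le_sup_left,
    not_le_sup_of_covBy hSDm hab hay hby haz hbz, sup_le hyx hzx⟩ le_sup_left)

/-- An unbounded chain above `a` avoiding `b` can be replaced by an unbounded chain starting at
`a` that spans a copy of `2 × ℕ` together with `b`. -/
theorem exists_strictMono_of_covBy {L : Type*} [Lattice L]
    (hSDm : ∀ a b c : L, a ⊓ b = a ⊓ c → a ⊓ b = a ⊓ (b ⊔ c))
    (hfin : ∀ u v : L, (Set.Icc u v).Finite) {a b : L} (hab : a ⋖ b)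
    {f : ℕ → L} (haf : ∀ n, a ≤ f n) (hbf : ∀ n, ¬ b ≤ f n) (hf : ¬ ∃ u, ∀ n, f n ≤ u) :
    ∃ α : ℕ → L, StrictMono α ∧ α 0 = a ∧ (∀ n, f n ≤ α (n + 1)) ∧ (∀ n, ¬ b ≤ α n) ∧
      ∀ m n, m ≤ n → (b ⊔ α m) ⊓ α n = α m := by
  have step : ∀ (n : ℕ) (x : {x // IsJoinClosed a b x}),
      ∃ y : {x // IsJoinClosed a b x}, x.1 < y.1 ∧ f n ≤ y.1 := by
    rintro n ⟨x, hx⟩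
    obtain ⟨k, hk⟩ : ∃ k, ¬ f k ≤ x := by
      by_contra! h
      exact hf ⟨x, h⟩
    have hbxk := not_le_sup_of_covBy hSDm hab hx.1 hx.2.1 (haf k) (hbf k)
    have hax : a ≤ x ⊔ f k := hx.1.trans le_sup_left
    obtain ⟨y, hy, hxy⟩ := exists_isJoinClosed_ge hSDm hfin hab (hax.trans le_sup_left)
      (not_le_sup_of_covBy hSDm hab hax hbxk (haf n) (hbf n))
    have hxky : x ⊔ f k ≤ y := le_sup_left.trans hxy
    exact ⟨⟨y, hy⟩, lt_of_le_not_ge (le_sup_left.trans hxky)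
      fun h => hk ((le_sup_right.trans hxky).trans h), le_sup_right.trans hxy⟩
  choose next hlt hle using step
  let α : ℕ → {x // IsJoinClosed a b x} :=
    fun n => Nat.rec ⟨a, isJoinClosed_self_of_covBy hab⟩ next n
  have hα : StrictMono fun n => (α n).1 := strictMono_nat_of_lt_succ fun n => hlt n (α n)
  refine ⟨fun n => (α n).1, hα, rfl, fun n => hle n (α n), fun n => (α n).2.2.1,
    fun m n hmn => le_antisymm ?_ (le_inf le_sup_right (hα.monotone hmn))⟩
  exact (α m).2.2.2 _ (le_inf ((α m).2.1.trans le_sup_right) (α n).2.1)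
    (fun h => (α n).2.2.1 (h.trans inf_le_right)) inf_le_left

/-- Two chains indexed by `ℤ` that interlock like the two rows of `2 × ℤ` form a sublattice
isomorphic to `2 × ℤ`. -/
theorem exists_orderIso_of_rows {L : Type*} [Lattice L] {A B : ℤ → L} (hA : StrictMono A)
    (hB : Monotone B) (hAB : ∀ n, A n ≤ B n) (hBA : ∀ m n, ¬ B m ≤ A n)
    (hinf : ∀ m n, m ≤ n → A n ⊓ B m = A m) (hsup : ∀ m n, m ≤ n → A n ⊔ B m = B n) :
    ∃ (H : Set L) (_ : ∀ x ∈ H, ∀ y ∈ H, x ⊔ y ∈ H ∧ x ⊓ y ∈ H) (φ : (Fin 2 × ℤ) ≃o H),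
      ∀ n, (φ (0, n) : L) = A n ∧ (φ (1, n) : L) = B n := by
  have hABle : ∀ m n, A m ≤ B n → m ≤ n := by
    intro m n h
    by_contra! hnm
    have := hinf n m hnm.le
    rw [inf_eq_left.mpr h] at this
    exact hnm.ne' (hA.injective this)
  let ψ : Fin 2 × ℤ → L := fun p => if p.1 = 0 then A p.2 else B p.2
  have hψ : ∀ p q, ψ p ≤ ψ q ↔ p ≤ q := by
    rintro ⟨i, m⟩ ⟨j, n⟩
    fin_cases i <;> fin_cases j <;> simp [ψ, Prod.le_def]
    · exact hA.le_iff_le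
    · exact ⟨hABle m n, fun h => (hA.monotone h).trans (hAB n)⟩
    · exact hBA m n
    · exact ⟨fun h => hABle m n ((hAB m).trans h), fun h => hB h⟩
  let e : Fin 2 × ℤ ↪o L := OrderEmbedding.ofMapLEIff ψ hψ
  have hsup' : ∀ p q, ψ p ⊔ ψ q = ψ (p ⊔ q) := by
    have mixed : ∀ m n, A m ⊔ B n = B (m ⊔ n) := by
      intro m n
      rcases le_total m n with h | h
      · rw [sup_eq_right.mpr h, sup_eq_right.mpr ((hA.monotone h).trans (hAB n))]
      · rw [sup_eq_left.mpr h, hsup n m h]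
    rintro ⟨i, m⟩ ⟨j, n⟩
    fin_cases i <;> fin_cases j <;> simp [ψ]
    · exact (hA.monotone.map_sup m n).symm
    · exact mixed m n
    · rw [sup_comm, mixed, sup_comm]
    · exact (hB.map_sup m n).symm
  have hinf' : ∀ p q, ψ p ⊓ ψ q = ψ (p ⊓ q) := by
    have mixed : ∀ m n, A m ⊓ B n = A (m ⊓ n) := by
      intro m n
      rcases le_total m n with h | h
      · rw [inf_eq_left.mpr h, inf_eq_left.mpr ((hA.monotone h).trans (hAB n))]
      · rw [inf_eq_right.mpr h, hinf n m h]
    rintro ⟨i, m⟩ ⟨j, n⟩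
    fin_cases i <;> fin_cases j <;> simp [ψ]
    · exact (hA.monotone.map_inf m n).symm
    · exact mixed m n
    · rw [inf_comm, mixed, inf_comm]
    · exact (hB.map_inf m n).symm
  refine ⟨Set.range e, ?_, e.orderIso, fun n => ⟨rfl, rfl⟩⟩
  rintro _ ⟨p, rfl⟩ _ ⟨q, rfl⟩
  exact ⟨⟨p ⊔ q, (hsup' p q).symm⟩, ⟨p ⊓ q, (hinf' p q).symm⟩⟩

/-- The row of `ℤ` made of `u` on the nonnegative and `v` on the nonpositive integers. -/
def intRow {L : Type*} (u v : ℕ → L) (n : ℤ) : L :=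
  if 0 ≤ n then u n.toNat else v (-n).toNat

theorem intRow_natCast {L : Type*} (u v : ℕ → L) (n : ℕ) : intRow u v n = u n := by
  simp [intRow]

theorem intRow_neg_natCast {L : Type*} {u v : ℕ → L} (h : u 0 = v 0) (n : ℕ) :
    intRow u v (-n) = v n := by
  rcases Nat.eq_zero_or_pos n with rfl | hn
  · simpa [intRow] using h
  · simp [intRow, hn.ne']

theorem monotone_intRow {L : Type*} [Preorder L] {u v : ℕ → L} (h : u 0 = v 0)
    (hu : Monotone u) (hv : Antitone v) : Monotone (intRow u v) := by
  intro m n hmn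
  obtain ⟨k, rfl | rfl⟩ := m.eq_nat_or_neg <;> obtain ⟨l, rfl | rfl⟩ := n.eq_nat_or_neg <;>
    simp only [intRow_natCast, intRow_neg_natCast h]
  · exact hu (by omega)
  · obtain rfl : k = 0 := by omega
    obtain rfl : l = 0 := by omega
    exact h.le
  · exact (hv (Nat.zero_le k)).trans (h.ge.trans (hu (Nat.zero_le l)))
  · exact hv (by omega)

/-- Let `L` be a countably infinite semidistributive lattice satisfying Whitman's condition in
which every closed interval is finite, and suppose `L` has a spanning cover `a ⋖ b`. Then `L`
contains a sublattice `H` together with a lattice isomorphism `φ : 2 × ℤ → H` such that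
`φ (0, 0) = a` and `φ (1, 0) = b`, and `H` has no upper bound and no lower bound in `L`. -/
theorem statement13 (L : Type*) [Lattice L] [Countable L] [Infinite L]
    (hSDj : ∀ a b c : L, a ⊔ b = a ⊔ c → a ⊔ b = a ⊔ (b ⊓ c))
    (hSDm : ∀ a b c : L, a ⊓ b = a ⊓ c → a ⊓ b = a ⊓ (b ⊔ c))
    (hW : ∀ a b c d : L, a ⊓ b ≤ c ⊔ d → a ≤ c ⊔ d ∨ b ≤ c ⊔ d ∨ a ⊓ b ≤ c ∨ a ⊓ b ≤ d)
    (hfin : ∀ u v : L, (Set.Icc u v).Finite)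
    (a b : L) (hspan : IsSpanningCover a b) :
    ∃ (H : Set L) (_ : ∀ x ∈ H, ∀ y ∈ H, x ⊔ y ∈ H ∧ x ⊓ y ∈ H)
      (φ : (Fin 2 × ℤ) ≃o H),
      (φ (0, 0) : L) = a ∧ (φ (1, 0) : L) = b ∧
      (¬ ∃ u : L, ∀ x ∈ H, x ≤ u) ∧ (¬ ∃ l : L, ∀ x ∈ H, l ≤ x) := by
  obtain ⟨hab, ⟨f, hf0, hfmono, hfub, hfb⟩, ⟨g, hg0, hganti, hglb, hga⟩⟩ := hspan
  obtain ⟨α, hα, hα0, hfα, hbα, hαinf⟩ := exists_strictMono_of_covBy hSDm hfin hab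
    (fun n => hf0.le.trans (hfmono.monotone (Nat.zero_le n))) (fun n => (hfb n).1) hfub
  obtain ⟨β, hβ, hβ0, hgβ, hβa, hβsup⟩ : ∃ β : ℕ → L, StrictAnti β ∧ β 0 = b ∧
      (∀ n, β (n + 1) ≤ g n) ∧ (∀ n, ¬ β n ≤ a) ∧
      ∀ m n, m ≤ n → (a ⊓ β m) ⊔ β n = β m := by
    refine exists_strictMono_of_covBy (L := Lᵒᵈ) hSDj ?_ hab.toDual
      (fun n => (hganti.antitone (Nat.zero_le n)).trans hg0.le) (fun n => (hga n).2) hglb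
    intro u v
    exact (hfin v.ofDual u.ofDual).subset fun x hx => ⟨hx.2, hx.1⟩
  have hαa : ∀ n, a ≤ α n := fun n => hα0.ge.trans (hα.monotone (Nat.zero_le n))
  have hβb : ∀ n, β n ≤ b := fun n => (hβ.antitone (Nat.zero_le n)).trans hβ0.le
  have hbinf : ∀ n, b ⊓ α n = a := fun n => inf_eq_of_covBy hab (hαa n) (hbα n)
  have hasup : ∀ n, a ⊔ β n = b := fun n =>
    inf_eq_of_covBy (L := Lᵒᵈ) hab.toDual (hβb n) (hβa n)
  have hA0 : α 0 = a ⊓ β 0 := by rw [hα0, hβ0, inf_eq_left.mpr hab.le]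
  have hB0 : b ⊔ α 0 = β 0 := by rw [hα0, hβ0, sup_eq_left.mpr hab.le]
  let A := intRow α fun n => a ⊓ β n
  let B := intRow (fun n => b ⊔ α n) β
  have hApos : ∀ n : ℕ, A n = α n := intRow_natCast _ _
  have hAneg : ∀ n : ℕ, A (-n) = a ⊓ β n := intRow_neg_natCast hA0
  have hBpos : ∀ n : ℕ, B n = b ⊔ α n := intRow_natCast _ _
  have hBneg : ∀ n : ℕ, B (-n) = β n := intRow_neg_natCast hB0
  have hA : Monotone A := monotone_intRow hA0 hα.monotone
    fun m n h => inf_le_inf_left a (hβ.antitone h)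
  have hB : Monotone B := monotone_intRow hB0
    (fun m n h => sup_le_sup_left (hα.monotone h) b) hβ.antitone
  have hinf : ∀ m n, m ≤ n → A n ⊓ B m = A m := by
    intro m n hmn
    obtain ⟨k, rfl | rfl⟩ := m.eq_nat_or_neg <;> obtain ⟨l, rfl | rfl⟩ := n.eq_nat_or_neg <;>
      simp only [hApos, hAneg, hBpos, hBneg]
    · rw [inf_comm, hαinf k l (by omega)]
    · obtain rfl : k = 0 := by omega
      obtain rfl : l = 0 := by omega
      rw [hB0, inf_assoc, inf_idem, hA0]
    · rw [← inf_eq_right.mpr (hβb k), ← inf_assoc, inf_comm (α l), hbinf, inf_eq_right.mpr (hβb k)]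
    · rw [inf_assoc, inf_eq_right.mpr (hβ.antitone (by omega))]
  have hsup : ∀ m n, m ≤ n → A n ⊔ B m = B n := by
    intro m n hmn
    obtain ⟨k, rfl | rfl⟩ := m.eq_nat_or_neg <;> obtain ⟨l, rfl | rfl⟩ := n.eq_nat_or_neg <;>
      simp only [hApos, hAneg, hBpos, hBneg]
    · rw [sup_left_comm, sup_eq_left.mpr (hα.monotone (by omega))]
    · obtain rfl : k = 0 := by omega
      obtain rfl : l = 0 := by omega
      rw [hB0, sup_eq_right.mpr inf_le_right]
    · rw [← sup_eq_left.mpr (hαa l), sup_assoc, hasup, sup_eq_left.mpr (hαa l), sup_comm]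
    · exact hβsup l k (by omega)
  have hAB : ∀ n, A n ≤ B n := fun n => inf_eq_left.mp (hinf n n le_rfl)
  have hBA : ∀ m n, ¬ B m ≤ A n := by
    intro m n h
    have hle : B (m ⊓ 0) ≤ A (n ⊔ 0) := (hB inf_le_left).trans (h.trans (hA le_sup_left))
    obtain ⟨k, hk⟩ := Int.eq_ofNat_of_zero_le (le_sup_right : 0 ≤ n ⊔ 0)
    have hsup0 := hsup (m ⊓ 0) (n ⊔ 0) (inf_le_right.trans le_sup_right)
    rw [sup_eq_left.mpr hle, hk, hApos, hBpos] at hsup0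
    exact hbα k (le_sup_left.trans hsup0.ge)
  have hAstrict : StrictMono A := by
    intro m n hmn
    refine lt_of_le_not_ge (hA hmn.le) fun h => ?_
    have hBnm : B n ≤ B m := by
      rw [← hsup m n hmn.le]
      exact sup_le (h.trans (hAB m)) le_rfl
    obtain ⟨k, rfl | rfl⟩ := m.eq_nat_or_neg <;> obtain ⟨l, rfl | rfl⟩ := n.eq_nat_or_neg
    · rw [hApos, hApos] at h
      exact (hα (show k < l by omega)).not_ge h
    · omega
    · rcases Nat.eq_zero_or_pos l with rfl | hl
      · rw [hBneg, hBpos, hB0] at hBnm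
        exact (hβ (show 0 < k by omega)).not_ge hBnm
      · rw [hApos, hAneg] at h
        exact (hα hl).not_ge ((h.trans inf_le_left).trans hα0.ge)
    · rw [hBneg, hBneg] at hBnm
      exact (hβ (show l < k by omega)).not_ge hBnm
  obtain ⟨H, hH, φ, hφ⟩ := exists_orderIso_of_rows hAstrict hB hAB hBA hinf hsup
  refine ⟨H, hH, φ, ?_, ?_, ?_, ?_⟩
  · exact (hφ 0).1.trans ((hApos 0).trans hα0)
  · exact (hφ 0).2.trans ((hBneg 0).trans hβ0)
  · rintro ⟨u, hu⟩
    refine hfub ⟨u, fun n => (hfα n).trans ?_⟩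
    rw [← hApos, ← (hφ _).1]
    exact hu _ (φ _).2
  · rintro ⟨l, hl⟩
    refine hglb ⟨l, fun n => le_trans ?_ (hgβ n)⟩
    rw [← hBneg, ← (hφ _).2]
    exact hl _ (φ _).2
end

section
/- Let L be a countably infinite semidistributive lattice satisfying Whitman's condition in which every closed interval [u, v] = {w : u ≤ w ≤ v} is finite, and suppose L has a spanning cover a ⋖ b. Then there exists a partition L = A ∪ B of L with A and B disjoint, a ∈ A, b ∈ B, such that A and B are sublattices of L, together with a sublattice H of L and a lattice isomorphism φ : 2 × ℤ → H satisfying: φ(0, k) ∈ A and φ(1, k) ∈ B for all k ∈ ℤ, φ(0, 0) = a, φ(1, 0) = b, and moreover (1) for all x ∈ B \ H and k ∈ ℤ, φ(0, k) ≤ x implies φ(1, k) ≤ x, and dually for all x ∈ A \ H and k ∈ ℤ, x ≤ φ(1, k) implies x ≤ φ(0, k); and (2) for every x ∈ (A ∪ B) \ H, if H_x denotes the sublattice of L generated by H ∪ {x}, then the set H_x \ H is finite. -/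
section Ladder

variable {L : Type*} [Lattice L]

/-- The hypotheses on the lattice and the cover, bundled so that they can be dualized at once. -/
structure LadderSetting (a b : L) : Prop where
  sdJoin : ∀ a b c : L, a ⊔ b = a ⊔ c → a ⊔ b = a ⊔ (b ⊓ c)
  sdMeet : ∀ a b c : L, a ⊓ b = a ⊓ c → a ⊓ b = a ⊓ (b ⊔ c)
  whitman : ∀ a b c d : L,
    a ⊓ b ≤ c ⊔ d → a ≤ c ⊔ d ∨ b ≤ c ⊔ d ∨ a ⊓ b ≤ c ∨ a ⊓ b ≤ d
  finite_Icc : ∀ u v : L, (Set.Icc u v).Finite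
  spanning : IsSpanningCover a b

/-- A pair `p ≤ q` such that `p` is the largest element of `A` below `q` and `q` is the smallest
element outside `A` above `p`. -/
structure IsRung (A : Set L) (p q : L) : Prop where
  mem : p ∈ A
  notMem : q ∉ A
  le : p ≤ q
  le_of_mem : ∀ x ∈ A, x ≤ q → x ≤ p
  le_of_notMem : ∀ x ∉ A, p ≤ x → q ≤ x

/-- The elements whose join with `a` is not above `b`. -/
def lowerPart (a b : L) : Set L := {x | ¬ b ≤ x ⊔ a}

theorem isLowerSet_lowerPart (a b : L) : IsLowerSet (lowerPart a b) :=
  fun _ _ hyx hx hb => hx (hb.trans (sup_le_sup_right hyx a))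

namespace LadderSetting

variable {a b : L}

theorem dual (h : LadderSetting a b) :
    LadderSetting (OrderDual.toDual b) (OrderDual.toDual a) where
  sdJoin := h.sdMeet
  sdMeet := h.sdJoin
  whitman x y z w hle := by
    rcases h.whitman (OrderDual.ofDual z) (OrderDual.ofDual w) (OrderDual.ofDual x)
      (OrderDual.ofDual y) hle with h1 | h1 | h1 | h1
    exacts [Or.inr (Or.inr (Or.inl h1)), Or.inr (Or.inr (Or.inr h1)), Or.inl h1,
      Or.inr (Or.inl h1)]
  finite_Icc u v := by
    refine (h.finite_Icc (OrderDual.ofDual v) (OrderDual.ofDual u)).subset ?_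
    exact fun x hx => ⟨hx.2, hx.1⟩
  spanning := by
    obtain ⟨hcov, ⟨f, hf0, hf, hfu, hfi⟩, g, hg0, hg, hgu, hgi⟩ := h.spanning
    exact ⟨hcov.toDual, ⟨g, hg0, fun _ _ hlt => hg hlt, hgu, fun n => (hgi n).symm⟩,
      f, hf0, fun _ _ hlt => hf hlt, hfu, fun n => (hfi n).symm⟩

theorem inf_eq_of_mem (h : LadderSetting a b) {x : L} (hx : x ∈ lowerPart a b) :
    b ⊓ (x ⊔ a) = a := by
  rcases h.spanning.1.eq_or_eq (le_inf h.spanning.1.le le_sup_right) inf_le_left with h1 | h1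
  · exact h1
  · exact absurd (inf_eq_left.1 h1) hx

theorem sup_mem (h : LadderSetting a b) {x y : L} (hx : x ∈ lowerPart a b)
    (hy : y ∈ lowerPart a b) : x ⊔ y ∈ lowerPart a b := by
  intro hb
  have key := h.sdMeet b (x ⊔ a) (y ⊔ a) ((h.inf_eq_of_mem hx).trans (h.inf_eq_of_mem hy).symm)
  rw [h.inf_eq_of_mem hx, ← sup_sup_distrib_right, inf_eq_left.2 hb] at key
  exact h.spanning.1.ne key

/-- The joins of `b` with the terms of the ascending sequence are cofinal. -/
theorem exists_le_sup (h : LadderSetting a b) {f : ℕ → L} (hf : StrictMono f)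
    (hfu : ¬ ∃ u : L, ∀ n, f n ≤ u) (hfi : ∀ n, ¬ b ≤ f n ∧ ¬ f n ≤ b) (x : L) :
    ∃ n, x ≤ b ⊔ f n := by
  by_contra! hx
  obtain ⟨hcov, -, g, hg0, -, -, hgi⟩ := h.spanning
  have hbg : b = a ⊔ g 0 := by
    rcases hcov.eq_or_eq (le_sup_left (b := g 0)) (sup_le hcov.le hg0.le) with h1 | h1
    · exact absurd (sup_eq_left.1 h1) (hgi 0).2
    · exact h1.symm
  let c : ℕ → L := fun n => (x ⊔ b) ⊓ (b ⊔ f n)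
  have hcm : Monotone c := fun m n hmn =>
    inf_le_inf_left _ (sup_le_sup_left (hf.monotone hmn) _)
  have hbc : ∀ n, b ≤ c n := fun n => le_inf le_sup_right le_sup_left
  have hcfin : (Set.range c).Finite := by
    refine (h.finite_Icc b (x ⊔ b)).subset ?_
    rintro _ ⟨n, rfl⟩
    exact ⟨hbc n, inf_le_left⟩
  obtain ⟨_, ⟨⟨N, rfl⟩, hmax⟩⟩ := hcfin.exists_maximal (Set.range_nonempty c)
  obtain ⟨m, hm⟩ : ∃ m, ¬ f m ≤ b ⊔ f N := by
    by_contra! hall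
    exact hfu ⟨_, hall⟩
  have hNm : N ≤ m := by
    by_contra! hlt
    exact hm ((hf.monotone hlt.le).trans le_sup_right)
  have hle : c m ≤ b ⊔ f N := (hmax ⟨m, rfl⟩ (hcm hNm)).trans inf_le_right
  rcases h.whitman _ _ _ _ hle with h1 | h1 | h1 | h1
  · exact hx N (le_sup_left.trans h1)
  · exact hm (le_sup_right.trans h1)
  · have h2 : (x ⊔ b) ⊓ (b ⊔ f m) ≤ a ⊔ g 0 := h1.trans hbg.le
    rcases h.whitman _ _ _ _ h2 with h3 | h3 | h3 | h3
    · exact hx 0 ((le_sup_left.trans (h3.trans hbg.ge)).trans le_sup_left)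
    · exact (hfi m).2 (le_sup_right.trans (h3.trans hbg.ge))
    · exact hcov.lt.not_ge ((hbc m).trans h3)
    · exact hg0.not_ge ((hbc m).trans h3)
  · exact (hfi N).1 ((hbc m).trans h1)

theorem le_sup_iff_not_inf_le (h : LadderSetting a b) (x : L) :
    b ≤ x ⊔ a ↔ ¬ x ⊓ b ≤ a := by
  obtain ⟨hcov, ⟨f, hf0, hf, hfu, hfi⟩, -⟩ := h.spanning
  constructor
  · intro hb hxa
    obtain ⟨n, hn⟩ := h.exists_le_sup hf hfu hfi x
    have haf : a ≤ f n := hf0.le.trans (hf.monotone n.zero_le)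
    have hbx : b ≤ f n ⊔ x := hb.trans (sup_le le_sup_right (haf.trans le_sup_left))
    have heq : f n ⊔ x = f n ⊔ b :=
      le_antisymm (sup_le le_sup_left (hn.trans_eq (sup_comm _ _))) (sup_le le_sup_left hbx)
    have key := h.sdJoin _ _ _ heq
    rw [sup_eq_left.2 (hxa.trans haf)] at key
    exact (hfi n).1 (hbx.trans key.le)
  · intro hxa
    rcases hcov.eq_or_eq (le_sup_right (a := x ⊓ b)) (sup_le inf_le_right hcov.le)
      with h1 | h1
    · exact absurd (sup_eq_right.1 h1) hxa
    · exact h1.ge.trans (sup_le_sup_right inf_le_left a)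

theorem lowerPart_dual (h : LadderSetting a b) :
    lowerPart (OrderDual.toDual b) (OrderDual.toDual a) =
      OrderDual.ofDual ⁻¹' (lowerPart a b)ᶜ := by
  ext x
  exact (h.le_sup_iff_not_inf_le (OrderDual.ofDual x)).symm.trans not_not.symm

theorem inf_notMem (h : LadderSetting a b) {x y : L} (hx : x ∉ lowerPart a b)
    (hy : y ∉ lowerPart a b) : x ⊓ y ∉ lowerPart a b := by
  have key := h.dual.sup_mem (x := OrderDual.toDual x) (y := OrderDual.toDual y)
  rw [h.lowerPart_dual] at key
  exact key hx hy

theorem left_mem (h : LadderSetting a b) : a ∈ lowerPart a b := fun hb =>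
  h.spanning.1.lt.not_ge (hb.trans (sup_idem a).le)

theorem right_notMem : b ∉ lowerPart a b := fun hb => hb le_sup_left

theorem right_le_of_notMem {x : L} (hx : x ∉ lowerPart a b) (hax : a ≤ x) :
    b ≤ x :=
  (not_not.1 hx).trans (sup_le le_rfl hax)

theorem isRung (h : LadderSetting a b) : IsRung (lowerPart a b) a b where
  mem := h.left_mem
  notMem := right_notMem
  le := h.spanning.1.le
  le_of_mem x hx hxb := by
    have := h.inf_eq_of_mem hx
    rw [inf_eq_right.2 (sup_le hxb h.spanning.1.le)] at this
    exact sup_eq_right.1 this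
  le_of_notMem _ hx hax := right_le_of_notMem hx hax

/-- The join of `b` with an element of the lower part is the upper end of a rung. -/
theorem exists_isRung_sup (h : LadderSetting a b) {y : L} (hy : y ∈ lowerPart a b) :
    ∃ p, IsRung (lowerPart a b) p (b ⊔ y) := by
  have hab := h.spanning.1.le
  have hS : (Set.Icc a (b ⊔ y) ∩ lowerPart a b).Finite := (h.finite_Icc _ _).inter_of_left _
  obtain ⟨p, ⟨⟨hap, hpv⟩, hp⟩, hmax⟩ :=
    hS.exists_maximal ⟨a, ⟨le_rfl, hab.trans le_sup_left⟩, h.left_mem⟩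
  have hlargest : ∀ x ∈ lowerPart a b, x ≤ b ⊔ y → x ≤ p := fun x hx hxv =>
    le_sup_left.trans
      (hmax ⟨⟨hap.trans le_sup_right, sup_le hxv hpv⟩, h.sup_mem hx hp⟩ le_sup_right)
  refine ⟨p, hp, fun hv => right_notMem (isLowerSet_lowerPart a b le_sup_left hv), hpv,
    hlargest, fun x hx hpx => ?_⟩
  exact sup_le (right_le_of_notMem hx (hap.trans hpx)) ((hlargest y hy le_sup_right).trans hpx)

/-- The half of the ladder above the rung `(a, b)`. -/
theorem exists_upper_rails (h : LadderSetting a b) :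
    ∃ p q : ℕ → L, p 0 = a ∧ q 0 = b ∧ StrictMono q ∧
      (∀ k, IsRung (lowerPart a b) (p k) (q k)) ∧ ∀ x, ∃ k, x ≤ q k := by
  obtain ⟨hcov, ⟨f, hf0, hf, hfu, hfi⟩, -⟩ := h.spanning
  have hfA : ∀ n, f n ∈ lowerPart a b := fun n hb =>
    (hfi n).1 (hb.trans (sup_le le_rfl (hf0.le.trans (hf.monotone n.zero_le))))
  have step : ∀ u : L, ∃ r : L × L, IsRung (lowerPart a b) r.1 r.2 ∧ u < r.2 := by
    intro u
    obtain ⟨n, hn⟩ := h.exists_le_sup hf hfu hfi u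
    obtain ⟨m, hm⟩ : ∃ m, ¬ f m ≤ u := by
      by_contra! hall
      exact hfu ⟨_, hall⟩
    obtain ⟨p, hp⟩ := h.exists_isRung_sup (hfA (max n m))
    refine ⟨(p, b ⊔ f (max n m)), hp, lt_of_le_not_ge ?_ fun hle => hm ?_⟩
    · exact hn.trans (sup_le_sup_left (hf.monotone (le_max_left n m)) b)
    · exact (hf.monotone (le_max_right n m)).trans (le_sup_right.trans hle)
  choose next hnext hlt using step
  let s : ℕ → L × L := fun k => Nat.rec (a, b) (fun n r => next (r.2 ⊔ f n)) k
  have hs : ∀ k, IsRung (lowerPart a b) (s k).1 (s k).2 := by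
    intro k
    cases k with
    | zero => exact h.isRung
    | succ k => exact hnext _
  have hmono : StrictMono fun k => (s k).2 :=
    strictMono_nat_of_lt_succ fun k => le_sup_left.trans_lt (hlt ((s k).2 ⊔ f k))
  refine ⟨fun k => (s k).1, fun k => (s k).2, rfl, rfl, hmono, hs, fun x => ?_⟩
  obtain ⟨n, hn⟩ := h.exists_le_sup hf hfu hfi x
  refine ⟨n + 1, hn.trans (sup_le (hmono.monotone (Nat.zero_le (n + 1))) ?_)⟩
  exact le_sup_right.trans (hlt ((s n).2 ⊔ f n)).le

/-- The half of the ladder below the rung `(a, b)`. -/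
theorem exists_lower_rails (h : LadderSetting a b) :
    ∃ p q : ℕ → L, p 0 = a ∧ q 0 = b ∧ StrictAnti p ∧
      (∀ k, IsRung (lowerPart a b) (p k) (q k)) ∧ ∀ x, ∃ k, p k ≤ x := by
  obtain ⟨q, p, hq0, hp0, hp, hr, hx⟩ := h.dual.exists_upper_rails
  rw [h.lowerPart_dual] at hr
  refine ⟨fun k => OrderDual.ofDual (p k), fun k => OrderDual.ofDual (q k), hp0, hq0,
    fun _ _ hlt => hp hlt, fun k => ?_, fun x => hx (OrderDual.toDual x)⟩
  exact
    { mem := not_not.1 (hr k).notMem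
      notMem := (hr k).mem
      le := (hr k).le
      le_of_mem := fun x hx => (hr k).le_of_notMem (OrderDual.toDual x) (not_not.2 hx)
      le_of_notMem := fun x hx => (hr k).le_of_mem (OrderDual.toDual x) hx }

end LadderSetting

theorem IsRung.fst_le_fst_iff {A : Set L} {p q p' q' : L} (h : IsRung A p q)
    (h' : IsRung A p' q') : p ≤ p' ↔ q ≤ q' :=
  ⟨fun hp => h.le_of_notMem _ h'.notMem (hp.trans h'.le),
    fun hq => h'.le_of_mem _ h.mem (h.le.trans hq)⟩

theorem IsRung.fst_le_snd_iff {A : Set L} {p q p' q' : L} (h : IsRung A p q)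
    (h' : IsRung A p' q') : p ≤ q' ↔ q ≤ q' :=
  ⟨h.le_of_notMem _ h'.notMem, h.le.trans⟩

theorem LadderSetting.exists_rails {a b : L} (h : LadderSetting a b) :
    ∃ p q : ℤ → L, p 0 = a ∧ q 0 = b ∧ StrictMono q ∧
      (∀ k, IsRung (lowerPart a b) (p k) (q k)) ∧ (∀ x, ∃ k, x ≤ q k) ∧ ∀ x, ∃ k, p k ≤ x := by
  obtain ⟨p, q, hp0, hq0, hq, hr, hx⟩ := h.exists_upper_rails
  obtain ⟨p', q', hp0', hq0', hp', hr', hx'⟩ := h.exists_lower_rails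
  have hq' : ∀ k, q' (k + 1) < q' k := fun k =>
    lt_of_le_not_ge (((hr' _).fst_le_fst_iff (hr' _)).1 (hp' k.lt_succ_self).le)
      fun hle => (hp' k.lt_succ_self).not_ge (((hr' _).fst_le_fst_iff (hr' _)).2 hle)
  refine ⟨fun k => Int.rec p (fun n => p' (n + 1)) k, fun k => Int.rec q (fun n => q' (n + 1)) k,
    hp0, hq0, strictMono_int_of_lt_succ fun k => ?_, fun k => ?_, fun x => ?_, fun x => ?_⟩
  · rcases k with k | k
    · exact hq k.lt_succ_self
    · rcases k with _ | k
      · have := hq' 0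
        rw [hq0', ← hq0] at this
        exact this
      · exact hq' (k + 1)
  · rcases k with k | k
    · exact hr k
    · exact hr' (k + 1)
  · obtain ⟨k, hk⟩ := hx x
    exact ⟨Int.ofNat k, hk⟩
  · obtain ⟨k, hk⟩ := hx' x
    exact ⟨Int.negSucc k, (hp' k.lt_succ_self).le.trans hk⟩

/-- The map from `2 × ℤ` with the given rails. -/
def ladderMap (p q : ℤ → L) (i : Fin 2 × ℤ) : L := if i.1 = 0 then p i.2 else q i.2

section Rails

variable {A : Set L} {p q : ℤ → L}

theorem ladderMap_le_iff (hA : IsLowerSet A) (hq : StrictMono q)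
    (hr : ∀ k, IsRung A (p k) (q k)) (i j : Fin 2 × ℤ) :
    ladderMap p q i ≤ ladderMap p q j ↔ i ≤ j := by
  obtain ⟨i, k⟩ := i
  obtain ⟨j, l⟩ := j
  have hqp : ¬ q k ≤ p l := fun hle => (hr k).notMem (hA hle (hr l).mem)
  fin_cases i <;> fin_cases j <;>
    simp [ladderMap, Prod.le_def, hq.le_iff_le, (hr k).fst_le_fst_iff (hr l),
      (hr k).fst_le_snd_iff (hr l), hqp]

theorem mem_range_ladderMap (hr : ∀ k, IsRung A (p k) (q k)) {x : L} :
    x ∈ Set.range (ladderMap p q) ↔ ∃ k, x ∈ Set.Icc (p k) (q k) := by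
  constructor
  · rintro ⟨⟨i, k⟩, rfl⟩
    refine ⟨k, ?_⟩
    unfold ladderMap
    split_ifs
    exacts [⟨le_rfl, (hr k).le⟩, ⟨(hr k).le, le_rfl⟩]
  · rintro ⟨k, hpx, hxq⟩
    by_cases hx : x ∈ A
    · exact ⟨(0, k), le_antisymm hpx ((hr k).le_of_mem x hx hxq)⟩
    · exact ⟨(1, k), le_antisymm ((hr k).le_of_notMem x hx hpx) hxq⟩

/-- Adjoining to the ladder an interval between two of its rungs yields a sublattice. -/
theorem isSublattice_ladder_union_Icc (hq : StrictMono q)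
    (hr : ∀ k, IsRung A (p k) (q k)) {m l : ℤ} (hml : m ≤ l) :
    IsSublattice (Set.range (ladderMap p q) ∪ Set.Icc (p m) (q l)) := by
  have hp : Monotone p := fun k j hkj => ((hr k).fst_le_fst_iff (hr j)).2 (hq.monotone hkj)
  have hS : ∀ x, x ∈ Set.range (ladderMap p q) ∪ Set.Icc (p m) (q l) ↔
      ∃ i j, (i = j ∨ i = m ∧ j = l) ∧ p i ≤ x ∧ x ≤ q j := by
    intro x
    rw [Set.mem_union, mem_range_ladderMap hr]
    constructor
    · rintro (⟨k, hk⟩ | hx)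
      exacts [⟨k, k, Or.inl rfl, hk⟩, ⟨m, l, Or.inr ⟨rfl, rfl⟩, hx⟩]
    · rintro ⟨i, j, rfl | ⟨rfl, rfl⟩, hx⟩
      exacts [Or.inl ⟨i, hx⟩, Or.inr hx]
  have hSle : ∀ {x : L} {i j : ℤ}, p i ≤ x → x ≤ q j → (j ≤ i ∨ m ≤ i ∧ j ≤ l) →
      x ∈ Set.range (ladderMap p q) ∪ Set.Icc (p m) (q l) := by
    rintro x i j hi hj (hji | ⟨hmi, hjl⟩)
    · exact (hS x).2 ⟨i, i, Or.inl rfl, hi, hj.trans (hq.monotone hji)⟩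
    · exact (hS x).2 ⟨m, l, Or.inr ⟨rfl, rfl⟩, (hp hmi).trans hi, hj.trans (hq.monotone hjl)⟩
  constructor
  · intro x hx y hy
    obtain ⟨i, j, hij, hix, hxj⟩ := (hS x).1 hx
    obtain ⟨i', j', hij', hiy, hyj⟩ := (hS y).1 hy
    refine hSle (i := max i i') (j := max j j') ?_
      ((sup_le_sup hxj hyj).trans (hq.monotone.le_map_sup j j')) (by omega)
    rcases max_choice i i' with e | e <;> rw [e]
    exacts [hix.trans le_sup_left, hiy.trans le_sup_right]
  · intro x hx y hy
    obtain ⟨i, j, hij, hix, hxj⟩ := (hS x).1 hx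
    obtain ⟨i', j', hij', hiy, hyj⟩ := (hS y).1 hy
    refine hSle (i := min i i') (j := min j j')
      ((hp.map_inf_le i i').trans (inf_le_inf hix hiy)) ?_ (by omega)
    rcases min_choice j j' with e | e <;> rw [e]
    exacts [inf_le_left.trans hxj, inf_le_right.trans hyj]

theorem isSublattice_ladder (hq : StrictMono q) (hr : ∀ k, IsRung A (p k) (q k)) :
    IsSublattice (Set.range (ladderMap p q)) := by
  have key := isSublattice_ladder_union_Icc hq hr (le_refl 0)
  rwa [Set.union_eq_left.2 fun x hx => (mem_range_ladderMap hr).2 ⟨0, hx⟩] at key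

end Rails

end Ladder

/-- Ladder splitting theorem: a countably infinite semidistributive lattice satisfying Whitman's
condition, with all closed intervals finite and possessing a spanning cover `a ⋖ b`, admits a
partition `L = A ∪ B` into sublattices, with `a ∈ A`, `b ∈ B`, containing a ladder
`H ≅ 2 × ℤ` whose bottom rail lies in `A` and top rail lies in `B`, satisfying conditions
(1) and (2) below (and the dual of (1) for `A`). -/
theorem statement14 (L : Type*) [Lattice L] [Countable L] [Infinite L]
    (hSDj : ∀ a b c : L, a ⊔ b = a ⊔ c → a ⊔ b = a ⊔ (b ⊓ c))
    (hSDm : ∀ a b c : L, a ⊓ b = a ⊓ c → a ⊓ b = a ⊓ (b ⊔ c))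
    (hW : ∀ a b c d : L, a ⊓ b ≤ c ⊔ d → a ≤ c ⊔ d ∨ b ≤ c ⊔ d ∨ a ⊓ b ≤ c ∨ a ⊓ b ≤ d)
    (hfin : ∀ u v : L, (Set.Icc u v).Finite)
    (a b : L) (hspan : IsSpanningCover a b) :
    ∃ A B : Set L,
      A ∪ B = Set.univ ∧ Disjoint A B ∧ a ∈ A ∧ b ∈ B ∧
      (∀ x ∈ A, ∀ y ∈ A, x ⊔ y ∈ A ∧ x ⊓ y ∈ A) ∧
      (∀ x ∈ B, ∀ y ∈ B, x ⊔ y ∈ B ∧ x ⊓ y ∈ B) ∧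
      ∃ (H : Set L) (_ : ∀ x ∈ H, ∀ y ∈ H, x ⊔ y ∈ H ∧ x ⊓ y ∈ H)
        (φ : (Fin 2 × ℤ) ≃o H),
        (∀ k : ℤ, (φ (0, k) : L) ∈ A ∧ (φ (1, k) : L) ∈ B) ∧
        (φ (0, 0) : L) = a ∧ (φ (1, 0) : L) = b ∧
        -- (1) and its dual
        (∀ x ∈ B \ H, ∀ k : ℤ, (φ (0, k) : L) ≤ x → (φ (1, k) : L) ≤ x) ∧
        (∀ x ∈ A \ H, ∀ k : ℤ, x ≤ (φ (1, k) : L) → x ≤ (φ (0, k) : L)) ∧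
        -- (2): for `x ∉ H`, the sublattice generated by `H ∪ {x}` adds only finitely many
        -- new elements
        (∀ x ∈ (A ∪ B) \ H, ((latticeClosure (H ∪ {x}) : Set L) \ H).Finite) := by
  have h : LadderSetting a b := ⟨hSDj, hSDm, hW, hfin, hspan⟩
  obtain ⟨p, q, hp0, hq0, hq, hr, hcofinal, hcoinitial⟩ := h.exists_rails
  have hA := isLowerSet_lowerPart a b
  refine ⟨lowerPart a b, (lowerPart a b)ᶜ, Set.union_compl_self _, disjoint_compl_right,
    h.left_mem, LadderSetting.right_notMem,
    fun x hx y hy => ⟨h.sup_mem hx hy, hA inf_le_left hx⟩,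
    fun x hx y hy => ⟨fun hxy => hx (hA le_sup_left hxy), h.inf_notMem hx hy⟩,
    Set.range (ladderMap p q), fun x hx y hy => ⟨(isSublattice_ladder hq hr).supClosed hx hy,
      (isSublattice_ladder hq hr).infClosed hx hy⟩,
    (OrderEmbedding.ofMapLEIff (ladderMap p q) (ladderMap_le_iff hA hq hr)).orderIso,
    fun k => ⟨(hr k).mem, (hr k).notMem⟩, hp0, hq0,
    fun x hx k hk => (hr k).le_of_notMem x hx.1 hk, fun x hx k hk => (hr k).le_of_mem x hx.1 hk,
    fun x _ => ?_⟩
  obtain ⟨l, hl⟩ := hcofinal x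
  obtain ⟨m, hm⟩ := hcoinitial x
  have hml : m ≤ l :=
    hq.le_iff_le.1 (((hr m).fst_le_snd_iff (hr l)).1 (hm.trans hl))
  refine (hfin (p m) (q l)).subset (Set.sdiff_subset_iff.2 ?_)
  refine latticeClosure_min (Set.union_subset_union_right _ ?_)
    (isSublattice_ladder_union_Icc hq hr hml)
  exact Set.singleton_subset_iff.2 ⟨hm, hl⟩
end
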